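/- arXiv:2605.22150 — 10 statements merged into one kernel-verified Lean document; each statement's English description precedes it below -/
import Mathlib

section
/- Let q > 1 be a real number and d ≥ 1. The function ρ ↦ (tr ρ^q)^{1/q} is strictly convex on the set of d×d density matrices: for any two density matrices ρ₁ ≠ ρ₂ on ℂ^d and any λ with 0 < λ < 1, one has (tr (λρ₁ + (1−λ)ρ₂)^q)^{1/q} < λ·(tr ρ₁^q)^{1/q} + (1−λ)·(tr ρ₂^q)^{1/q}. Equivalently, the unified entropy S_{q,1/q}(ρ) = (q/(q−1))·(1 − (tr ρ^q)^{1/q}) is strictly concave on density matrices. -/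
open scoped Kronecker Matrix ComplexOrder

/-- `tr ρ^α` for a Hermitian matrix `ρ`: the sum of the `α`-th real powers of its
eigenvalues, counted with multiplicity (`0^α = 0` for `α > 0`);
junk value `0` for non-Hermitian input. -/
noncomputable def trRPow {n : Type*} [Fintype n] [DecidableEq n]
    (ρ : Matrix n n ℂ) (α : ℝ) : ℝ :=
  if h : ρ.IsHermitian then ∑ i, h.eigenvalues i ^ α else 0

/-- `ρ^α` for a Hermitian matrix `ρ`, via the spectral decomposition: raise every
eigenvalue to the real power `α` (`0^α = 0` for `α ≠ 0`);
junk value `0` for non-Hermitian input. -/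
noncomputable def matRPow {n : Type*} [Fintype n] [DecidableEq n]
    (ρ : Matrix n n ℂ) (α : ℝ) : Matrix n n ℂ :=
  if h : ρ.IsHermitian then
    (h.eigenvectorUnitary : Matrix n n ℂ) *
      Matrix.diagonal (fun i => ((h.eigenvalues i ^ α : ℝ) : ℂ)) *
      star (h.eigenvectorUnitary : Matrix n n ℂ)
  else 0

/-- Strict Minkowski inequality for distinct probability vectors. -/
theorem sum_rpow_convexComb_lt {n : Type*} [Fintype n] {q : ℝ} (hq : 1 < q) {a b : n → ℝ}
    (ha : ∀ i, 0 ≤ a i) (hb : ∀ i, 0 ≤ b i) (hsa : ∑ i, a i = 1) (hsb : ∑ i, b i = 1)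
    (hab : a ≠ b) {l : ℝ} (hl0 : 0 < l) (hl1 : l < 1) :
    (∑ i, (l * a i + (1 - l) * b i) ^ q) ^ (1 / q) <
      l * (∑ i, a i ^ q) ^ (1 / q) + (1 - l) * (∑ i, b i ^ q) ^ (1 / q) := by
  have hq0 : 0 < q := by linarith
  have hl : 0 < 1 - l := by linarith
  have sum_rpow_pos : ∀ c : n → ℝ, (∀ i, 0 ≤ c i) → ∑ i, c i = 1 → 0 < ∑ i, c i ^ q := by
    intro c hc hsc
    obtain ⟨i, -, hi⟩ : ∃ i ∈ Finset.univ, c i ≠ 0 :=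
      Finset.exists_ne_zero_of_sum_ne_zero (by rw [hsc]; exact one_ne_zero)
    exact Finset.sum_pos' (fun i _ => Real.rpow_nonneg (hc i) q)
      ⟨i, Finset.mem_univ i, Real.rpow_pos_of_pos ((hc i).lt_of_ne' hi) q⟩
  have hPa := sum_rpow_pos a ha hsa
  have hPb := sum_rpow_pos b hb hsb
  set A := (∑ i, a i ^ q) ^ (1 / q) with hA
  set B := (∑ i, b i ^ q) ^ (1 / q) with hB
  have hA0 : 0 < A := Real.rpow_pos_of_pos hPa _
  have hB0 : 0 < B := Real.rpow_pos_of_pos hPb _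
  have hAq : A ^ q = ∑ i, a i ^ q := by
    rw [hA, ← Real.rpow_mul hPa.le, one_div_mul_cancel hq0.ne', Real.rpow_one]
  have hBq : B ^ q = ∑ i, b i ^ q := by
    rw [hB, ← Real.rpow_mul hPb.le, one_div_mul_cancel hq0.ne', Real.rpow_one]
  set N := l * A + (1 - l) * B with hN
  have hN0 : 0 < N := by positivity
  have hx : ∀ i, 0 ≤ a i / A := fun i => div_nonneg (ha i) hA0.le
  have hy : ∀ i, 0 ≤ b i / B := fun i => div_nonneg (hb i) hB0.le
  have ht : 0 < l * A / N := by positivity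
  have ht' : 0 < (1 - l) * B / N := by positivity
  have htt : l * A / N + (1 - l) * B / N = 1 := by rw [← add_div, ← hN, div_self hN0.ne']
  have hs : ∀ i, (l * a i + (1 - l) * b i) ^ q =
      N ^ q * (l * A / N * (a i / A) + (1 - l) * B / N * (b i / B)) ^ q := by
    intro i
    rw [← Real.mul_rpow hN0.le
      (add_nonneg (mul_nonneg ht.le (hx i)) (mul_nonneg ht'.le (hy i)))]
    congr 1
    field_simp
  have hconv := strictConvexOn_rpow hq
  have hlt : ∑ i, (l * A / N * (a i / A) + (1 - l) * B / N * (b i / B)) ^ q <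
      ∑ i, (l * A / N * (a i / A) ^ q + (1 - l) * B / N * (b i / B) ^ q) := by
    refine Finset.sum_lt_sum
      (fun i _ => hconv.convexOn.2 (hx i) (hy i) ht.le ht'.le htt) ?_
    by_contra! hcon
    have hxy : ∀ i, a i / A = b i / B := by
      intro i
      by_contra hne
      exact (hconv.2 (hx i) (hy i) hne ht ht' htt).not_ge (hcon i (Finset.mem_univ i))
    have hAB : 1 / A = 1 / B := by
      have := Finset.sum_congr rfl (fun i (_ : i ∈ Finset.univ) => hxy i)
      rwa [← Finset.sum_div, ← Finset.sum_div, hsa, hsb] at this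
    have hAB' : A = B := by simpa using hAB
    refine hab (funext fun i => ?_)
    have := hxy i
    rwa [hAB', div_left_inj' hB0.ne'] at this
  have hone : ∑ i, (l * A / N * (a i / A) ^ q + (1 - l) * B / N * (b i / B) ^ q) = 1 := by
    simp_rw [Real.div_rpow (ha _) hA0.le, Real.div_rpow (hb _) hB0.le]
    rw [Finset.sum_add_distrib, ← Finset.mul_sum, ← Finset.mul_sum, ← Finset.sum_div,
      ← Finset.sum_div, hAq, hBq, div_self hPa.ne', div_self hPb.ne', mul_one, mul_one, htt]
  have hfin : ∑ i, (l * a i + (1 - l) * b i) ^ q < N ^ q := by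
    simp_rw [hs]
    rw [← Finset.mul_sum]
    exact mul_lt_of_lt_one_right (Real.rpow_pos_of_pos hN0 q) (hlt.trans_eq hone)
  have hnonneg : 0 ≤ ∑ i, (l * a i + (1 - l) * b i) ^ q := Finset.sum_nonneg fun i _ =>
    Real.rpow_nonneg (add_nonneg (mul_nonneg hl0.le (ha i)) (mul_nonneg hl.le (hb i))) q
  calc _ < (N ^ q) ^ (1 / q) := Real.rpow_lt_rpow hnonneg hfin (by positivity)
    _ = N := by rw [← Real.rpow_mul hN0.le, mul_one_div_cancel hq0.ne', Real.rpow_one]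

section Unitary

variable {n : Type*} [Fintype n] [DecidableEq n]

theorem sum_normSq_row_of_mem_unitary {W : Matrix n n ℂ} (hW : W ∈ unitary (Matrix n n ℂ))
    (i : n) : ∑ j, Complex.normSq (W i j) = 1 := by
  have h := congrArg (fun M : Matrix n n ℂ => M i i) (Unitary.mul_star_self_of_mem hW)
  simp only [Matrix.mul_apply, Matrix.star_apply, Matrix.one_apply_eq, RCLike.star_def,
    Complex.mul_conj] at h
  exact_mod_cast h

theorem sum_normSq_col_of_mem_unitary {W : Matrix n n ℂ} (hW : W ∈ unitary (Matrix n n ℂ))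
    (j : n) : ∑ i, Complex.normSq (W i j) = 1 := by
  have h := sum_normSq_row_of_mem_unitary (Unitary.star_mem hW) j
  simpa [Matrix.star_apply] using h

theorem conj_diagonal_apply (W : Matrix n n ℂ) (c : n → ℝ) (i k : n) :
    (W * Matrix.diagonal (fun j => (c j : ℂ)) * star W) i k =
      ∑ j, W i j * c j * star (W k j) := by
  rw [Matrix.mul_apply]
  simp [Matrix.mul_diagonal, Matrix.star_apply]

theorem conj_diagonal_apply_self_re (W : Matrix n n ℂ) (c : n → ℝ) (i : n) :
    ((W * Matrix.diagonal (fun j => (c j : ℂ)) * star W) i i).re =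
      ∑ j, Complex.normSq (W i j) * c j := by
  rw [conj_diagonal_apply, Complex.re_sum]
  refine Finset.sum_congr rfl fun j _ => ?_
  rw [mul_right_comm, RCLike.star_def, Complex.mul_conj, ← Complex.ofReal_mul, Complex.ofReal_re]

variable {q : ℝ} {W : Matrix n n ℂ} {c : n → ℝ}

theorem rpow_conj_diagonal_apply_self_le (hq : 1 < q) (hW : W ∈ unitary (Matrix n n ℂ))
    (hc : ∀ i, 0 ≤ c i) (i : n) :
    ((W * Matrix.diagonal (fun j => (c j : ℂ)) * star W) i i).re ^ q ≤
      ∑ j, Complex.normSq (W i j) * c j ^ q := by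
  rw [conj_diagonal_apply_self_re]
  exact (strictConvexOn_rpow hq).convexOn.map_sum_le (fun j _ => Complex.normSq_nonneg (W i j))
    (sum_normSq_row_of_mem_unitary hW i) (fun j _ => hc j)

theorem sum_normSq_mul_of_mem_unitary (hW : W ∈ unitary (Matrix n n ℂ)) (f : n → ℝ) :
    ∑ i, ∑ j, Complex.normSq (W i j) * f j = ∑ j, f j := by
  rw [Finset.sum_comm]
  simp_rw [← Finset.sum_mul, sum_normSq_col_of_mem_unitary hW, one_mul]

theorem sum_rpow_conj_diagonal_apply_self_le (hq : 1 < q) (hW : W ∈ unitary (Matrix n n ℂ))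
    (hc : ∀ i, 0 ≤ c i) :
    ∑ i, ((W * Matrix.diagonal (fun j => (c j : ℂ)) * star W) i i).re ^ q ≤ ∑ j, c j ^ q := by
  rw [← sum_normSq_mul_of_mem_unitary hW fun j => c j ^ q]
  exact Finset.sum_le_sum fun i _ => rpow_conj_diagonal_apply_self_le hq hW hc i

theorem conj_diagonal_eq_diagonal_of_sum_rpow_eq (hq : 1 < q)
    (hW : W ∈ unitary (Matrix n n ℂ)) (hc : ∀ i, 0 ≤ c i)
    (h : ∑ i, ((W * Matrix.diagonal (fun j => (c j : ℂ)) * star W) i i).re ^ q =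
      ∑ j, c j ^ q) :
    W * Matrix.diagonal (fun j => (c j : ℂ)) * star W = Matrix.diagonal fun i =>
      ((((W * Matrix.diagonal (fun j => (c j : ℂ)) * star W) i i).re : ℝ) : ℂ) := by
  rw [← sum_normSq_mul_of_mem_unitary hW fun j => c j ^ q] at h
  have hrow := (Finset.sum_eq_sum_iff_of_le
    (fun i _ => rpow_conj_diagonal_apply_self_le hq hW hc i)).1 h
  ext i k
  have hi := hrow i (Finset.mem_univ i)
  rw [conj_diagonal_apply_self_re] at hi
  have heq := ((strictConvexOn_rpow hq).map_sum_eq_iff'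
    (fun j _ => Complex.normSq_nonneg (W i j))
    (sum_normSq_row_of_mem_unitary hW i) (fun j _ => hc j)).1 hi
  simp only [smul_eq_mul, ← conj_diagonal_apply_self_re] at heq
  set m := ((W * Matrix.diagonal (fun j => (c j : ℂ)) * star W) i i).re with hm
  have hterm : ∀ j, W i j * c j * star (W k j) = m * (W i j * star (W k j)) := by
    intro j
    by_cases hz : W i j = 0
    · simp [hz]
    · rw [heq j (Finset.mem_univ j) (by simpa using hz)]
      ring
  have horth : ∑ j, W i j * star (W k j) = (1 : Matrix n n ℂ) i k := by
    rw [← Unitary.mul_star_self_of_mem hW]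
    simp [Matrix.mul_apply, Matrix.star_apply]
  rw [conj_diagonal_apply, Finset.sum_congr rfl fun j _ => hterm j, ← Finset.mul_sum, horth]
  by_cases hik : i = k
  · subst hik
    simp [hm]
  · simp [hik]

end Unitary

theorem diag_conj_re_nonneg {n : Type*} [Fintype n] {ρ : Matrix n n ℂ}
    (h : ρ.PosSemidef)
    (U : Matrix n n ℂ) (i : n) : 0 ≤ ((star U * ρ * U) i i).re :=
  (Complex.le_def.1 ((h.conjTranspose_mul_mul_same U).diag_nonneg (i := i))).1

section Pinching

variable {n : Type*} [Fintype n] [DecidableEq n] {ρ : Matrix n n ℂ} {q : ℝ} {U : Matrix n n ℂ}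

theorem Matrix.IsHermitian.exists_unitary_conj_eq (h : ρ.IsHermitian)
    (hU : U ∈ unitary (Matrix n n ℂ)) :
    ∃ W ∈ unitary (Matrix n n ℂ), star U * ρ * U =
      W * Matrix.diagonal (fun j => (h.eigenvalues j : ℂ)) * star W := by
  refine ⟨star U * h.eigenvectorUnitary, mul_mem (Unitary.star_mem hU) h.eigenvectorUnitary.2, ?_⟩
  conv_lhs => rw [h.spectral_theorem, Unitary.conjStarAlgAut_apply]
  simp only [star_mul, star_star, Matrix.mul_assoc]
  rfl

theorem sum_rpow_diag_le_trRPow (hq : 1 < q) (h : ρ.PosSemidef)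
    (hU : U ∈ unitary (Matrix n n ℂ)) :
    ∑ i, ((star U * ρ * U) i i).re ^ q ≤ trRPow ρ q := by
  obtain ⟨W, hW, hWe⟩ := h.1.exists_unitary_conj_eq hU
  rw [trRPow, dif_pos h.1, hWe]
  exact sum_rpow_conj_diagonal_apply_self_le hq hW h.eigenvalues_nonneg

theorem eq_diagonal_of_sum_rpow_diag_eq_trRPow (hq : 1 < q) (h : ρ.PosSemidef)
    (hU : U ∈ unitary (Matrix n n ℂ))
    (he : ∑ i, ((star U * ρ * U) i i).re ^ q = trRPow ρ q) :
    star U * ρ * U = Matrix.diagonal fun i => (((star U * ρ * U) i i).re : ℂ) := by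
  obtain ⟨W, hW, hWe⟩ := h.1.exists_unitary_conj_eq hU
  rw [trRPow, dif_pos h.1, hWe] at he
  rw [hWe]
  exact conj_diagonal_eq_diagonal_of_sum_rpow_eq hq hW h.eigenvalues_nonneg he

theorem sum_diag_conj_re (hρ : ρ.trace = 1) (hU : U ∈ unitary (Matrix n n ℂ)) :
    ∑ i, ((star U * ρ * U) i i).re = 1 := by
  have h : (star U * ρ * U).trace = 1 := by
    rw [Matrix.trace_mul_comm, ← Matrix.mul_assoc, Unitary.mul_star_self_of_mem hU,
      Matrix.one_mul, hρ]
  rw [← Complex.re_sum]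
  exact congrArg Complex.re h

end Pinching

/-- Strict convexity of the Schatten `q`-norm on density matrices. -/
theorem trRPow_rpow_convexComb_lt {n : Type*} [Fintype n] [DecidableEq n] {q : ℝ} (hq : 1 < q)
    {ρ₁ ρ₂ : Matrix n n ℂ} (h₁ : ρ₁.PosSemidef) (htr₁ : ρ₁.trace = 1)
    (h₂ : ρ₂.PosSemidef) (htr₂ : ρ₂.trace = 1) (hne : ρ₁ ≠ ρ₂) {l : ℝ}
    (hl0 : 0 < l) (hl1 : l < 1) :
    trRPow (l • ρ₁ + (1 - l) • ρ₂) q ^ (1 / q) <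
      l * trRPow ρ₁ q ^ (1 / q) + (1 - l) * trRPow ρ₂ q ^ (1 / q) := by
  have hl : 0 < 1 - l := by linarith
  have hq0 : 0 < 1 / q := by positivity
  have hσ : (l • ρ₁ + (1 - l) • ρ₂).IsHermitian :=
    ((h₁.smul hl0.le).add (h₂.smul hl.le)).1
  set U : Matrix n n ℂ := (hσ.eigenvectorUnitary).1 with hUdef
  have hU : U ∈ unitary (Matrix n n ℂ) := hσ.eigenvectorUnitary.2
  set a : n → ℝ := fun i => ((star U * ρ₁ * U) i i).re with ha
  set b : n → ℝ := fun i => ((star U * ρ₂ * U) i i).re with hb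
  have hs : ∀ i, hσ.eigenvalues i = l * a i + (1 - l) * b i := by
    intro i
    have h := hσ.conjStarAlgAut_star_eigenvectorUnitary
    rw [Unitary.conjStarAlgAut_star_apply] at h
    have hi := congrArg Complex.re (congrFun (congrFun h i) i)
    rw [← hUdef] at hi
    simpa [Matrix.mul_add, Matrix.add_mul, ha, hb] using hi.symm
  have htr : trRPow (l • ρ₁ + (1 - l) • ρ₂) q = ∑ i, (l * a i + (1 - l) * b i) ^ q := by
    rw [trRPow, dif_pos hσ]
    simp_rw [hs]
  have ha0 : ∀ i, 0 ≤ a i := diag_conj_re_nonneg h₁ U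
  have hb0 : ∀ i, 0 ≤ b i := diag_conj_re_nonneg h₂ U
  have hsa : 0 ≤ ∑ i, a i ^ q := Finset.sum_nonneg fun i _ => Real.rpow_nonneg (ha0 i) q
  have hsb : 0 ≤ ∑ i, b i ^ q := Finset.sum_nonneg fun i _ => Real.rpow_nonneg (hb0 i) q
  have hle₁ : ∑ i, a i ^ q ≤ trRPow ρ₁ q := sum_rpow_diag_le_trRPow hq h₁ hU
  have hle₂ : ∑ i, b i ^ q ≤ trRPow ρ₂ q := sum_rpow_diag_le_trRPow hq h₂ hU
  have hle₁' := Real.rpow_le_rpow hsa hle₁ hq0.le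
  have hle₂' := Real.rpow_le_rpow hsb hle₂ hq0.le
  rw [htr]
  by_cases hab : a = b
  · have hmid : ∑ i, (l * a i + (1 - l) * b i) ^ q = ∑ i, a i ^ q := by
      rw [← hab]
      congr! 2
      ring
    rw [hmid]
    rw [← hab] at hle₂ hle₂'
    have hstrict : ∑ i, a i ^ q < trRPow ρ₁ q ∨ ∑ i, a i ^ q < trRPow ρ₂ q := by
      by_contra! hcon
      have e₁ := eq_diagonal_of_sum_rpow_diag_eq_trRPow hq h₁ hU (le_antisymm hle₁ hcon.1)
      have e₂ := eq_diagonal_of_sum_rpow_diag_eq_trRPow hq h₂ hU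
        (show ∑ i, b i ^ q = _ from hab ▸ le_antisymm hle₂ hcon.2)
      have e : star U * ρ₁ * U = star U * ρ₂ * U := by
        rw [e₁, e₂]
        exact congrArg (fun f : n → ℝ => Matrix.diagonal fun i => (f i : ℂ)) hab
      have hUU := Unitary.mul_star_self_of_mem hU
      have key : ∀ ρ : Matrix n n ℂ, U * (star U * ρ * U) * star U = ρ := fun ρ => by
        rw [Matrix.mul_assoc, Matrix.mul_assoc (star U * ρ), hUU, Matrix.mul_one,
          ← Matrix.mul_assoc, hUU, Matrix.one_mul]
      exact hne (by rw [← key ρ₁, e, key])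
    rcases hstrict with h | h
    · have := Real.rpow_lt_rpow hsa h hq0
      nlinarith
    · have := Real.rpow_lt_rpow hsa h hq0
      nlinarith
  · calc _ < l * (∑ i, a i ^ q) ^ (1 / q) + (1 - l) * (∑ i, b i ^ q) ^ (1 / q) :=
          sum_rpow_convexComb_lt hq ha0 hb0 (sum_diag_conj_re htr₁ hU)
            (sum_diag_conj_re htr₂ hU) hab hl0 hl1
      _ ≤ _ := add_le_add (mul_le_mul_of_nonneg_left hle₁' hl0.le)
          (mul_le_mul_of_nonneg_left hle₂' hl.le)

/-- For real `q > 1` and `d ≥ 1`, the map `ρ ↦ (tr ρ^q)^(1/q)` is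
strictly convex on `d × d` density matrices; equivalently, the unified entropy
`S_{q,1/q}(ρ) = (q/(q-1))·(1 - (tr ρ^q)^(1/q))` is strictly concave. -/
theorem unified_entropy_q_inv_q_strictly_concave
    {d : ℕ} (hd : 1 ≤ d) (q : ℝ) (hq : 1 < q)
    (ρ₁ ρ₂ : Matrix (Fin d) (Fin d) ℂ)
    (h₁ : ρ₁.PosSemidef) (htr₁ : ρ₁.trace = 1)
    (h₂ : ρ₂.PosSemidef) (htr₂ : ρ₂.trace = 1)
    (hne : ρ₁ ≠ ρ₂) (l : ℝ) (hl0 : 0 < l) (hl1 : l < 1) :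
    trRPow (l • ρ₁ + (1 - l) • ρ₂) q ^ (1/q) <
      l * trRPow ρ₁ q ^ (1/q) + (1 - l) * trRPow ρ₂ q ^ (1/q) ∧
    l * (q/(q-1) * (1 - trRPow ρ₁ q ^ (1/q)))
        + (1 - l) * (q/(q-1) * (1 - trRPow ρ₂ q ^ (1/q))) <
      q/(q-1) * (1 - trRPow (l • ρ₁ + (1 - l) • ρ₂) q ^ (1/q)) := by
  have h := trRPow_rpow_convexComb_lt hq h₁ htr₁ h₂ htr₂ hne hl0 hl1
  refine ⟨h, ?_⟩
  have hc : 0 < q / (q - 1) := div_pos (by linarith) (by linarith)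
  have := mul_lt_mul_of_pos_left h hc
  linarith
end

section
/- Let q > 1 and s > 0 be real numbers with q·s ≥ 1, and let d ≥ 1. The function ρ ↦ (tr ρ^q)^s is strictly convex on the set of d×d density matrices: for any two density matrices ρ₁ ≠ ρ₂ on ℂ^d and any λ with 0 < λ < 1, one has (tr (λρ₁ + (1−λ)ρ₂)^q)^s < λ·(tr ρ₁^q)^s + (1−λ)·(tr ρ₂^q)^s. Equivalently, the unified-(q,s) entropy S_{q,s}(ρ) = (1/((q−1)s))·(1 − (tr ρ^q)^s) is strictly concave on density matrices. -/
open scoped Kronecker Matrix ComplexOrder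

/-- Strict Minkowski inequality for two distinct probability vectors. -/
theorem rpow_sum_convexComb_lt {ι : Type*} [Fintype ι] {q : ℝ} (hq : 1 < q) {a b : ι → ℝ}
    (ha : ∀ i, 0 ≤ a i) (hb : ∀ i, 0 ≤ b i) (hsa : ∑ i, a i = 1) (hsb : ∑ i, b i = 1)
    (hab : a ≠ b) {l : ℝ} (hl0 : 0 < l) (hl1 : l < 1) :
    (∑ i, (l * a i + (1 - l) * b i) ^ q) ^ (1 / q) <
      l * (∑ i, a i ^ q) ^ (1 / q) + (1 - l) * (∑ i, b i ^ q) ^ (1 / q) := by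
  have hq0 : 0 < q := by linarith
  have sum_pos : ∀ c : ι → ℝ, (∀ i, 0 ≤ c i) → ∑ i, c i = 1 → 0 < ∑ i, c i ^ q := by
    intro c hc hsc
    obtain ⟨i, -, hi⟩ := Finset.exists_ne_zero_of_sum_ne_zero (hsc.trans_ne one_ne_zero)
    exact Finset.sum_pos' (fun j _ => Real.rpow_nonneg (hc j) q)
      ⟨i, Finset.mem_univ i, Real.rpow_pos_of_pos (lt_of_le_of_ne (hc i) hi.symm) q⟩
  have hAq := sum_pos a ha hsa
  have hBq := sum_pos b hb hsb
  set A := (∑ i, a i ^ q) ^ (1 / q) with hA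
  set B := (∑ i, b i ^ q) ^ (1 / q) with hB
  have hA0 : 0 < A := Real.rpow_pos_of_pos hAq _
  have hB0 : 0 < B := Real.rpow_pos_of_pos hBq _
  have hAA : A ^ q = ∑ i, a i ^ q := by
    rw [hA, ← Real.rpow_mul hAq.le, one_div_mul_cancel hq0.ne', Real.rpow_one]
  have hBB : B ^ q = ∑ i, b i ^ q := by
    rw [hB, ← Real.rpow_mul hBq.le, one_div_mul_cancel hq0.ne', Real.rpow_one]
  have hl1' : 0 < 1 - l := by linarith
  set N := l * A + (1 - l) * B with hN
  have hN0 : 0 < N := by positivity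
  have hAN : 0 < l * A / N := by positivity
  have hBN : 0 < (1 - l) * B / N := by positivity
  have hw : l * A / N + (1 - l) * B / N = 1 := by rw [← add_div, ← hN, div_self hN0.ne']
  have key : ∃ i, a i / A ≠ b i / B := by
    by_contra! h
    have hsum : ∑ i, a i / A = ∑ i, b i / B := Finset.sum_congr rfl fun i _ => h i
    rw [← Finset.sum_div, ← Finset.sum_div, hsa, hsb] at hsum
    have hABeq : A = B := by simpa using hsum
    refine hab (funext fun i => ?_)
    have := h i
    rw [hABeq] at this
    exact (div_left_inj' hB0.ne').1 this
  obtain ⟨j, hj⟩ := key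
  have hcomb : ∀ i, (l * a i + (1 - l) * b i) / N =
      l * A / N * (a i / A) + (1 - l) * B / N * (b i / B) := by
    intro i; field_simp
  have hlt : ∑ i, ((l * a i + (1 - l) * b i) / N) ^ q <
      ∑ i, (l * A / N * (a i / A) ^ q + (1 - l) * B / N * (b i / B) ^ q) := by
    refine Finset.sum_lt_sum (fun i _ => ?_) ⟨j, Finset.mem_univ j, ?_⟩
    · rw [hcomb]
      exact (convexOn_rpow hq.le).2 (div_nonneg (ha i) hA0.le) (div_nonneg (hb i) hB0.le)
        hAN.le hBN.le hw
    · rw [hcomb]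
      exact (strictConvexOn_rpow hq).2 (div_nonneg (ha j) hA0.le) (div_nonneg (hb j) hB0.le)
        hj hAN hBN hw
  have hxA : ∑ i, (a i / A) ^ q = 1 := by
    simp_rw [fun i => Real.div_rpow (ha i) hA0.le q]
    rw [← Finset.sum_div, hAA, div_self hAq.ne']
  have hxB : ∑ i, (b i / B) ^ q = 1 := by
    simp_rw [fun i => Real.div_rpow (hb i) hB0.le q]
    rw [← Finset.sum_div, hBB, div_self hBq.ne']
  have hμ : ∀ i, 0 ≤ l * a i + (1 - l) * b i := fun i =>
    add_nonneg (mul_nonneg hl0.le (ha i)) (mul_nonneg hl1'.le (hb i))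
  rw [Finset.sum_add_distrib, ← Finset.mul_sum, ← Finset.mul_sum, hxA, hxB, mul_one, mul_one, hw]
    at hlt
  simp_rw [fun i => Real.div_rpow (hμ i) hN0.le q] at hlt
  rw [← Finset.sum_div, div_lt_one (by positivity)] at hlt
  calc (∑ i, (l * a i + (1 - l) * b i) ^ q) ^ (1 / q) < (N ^ q) ^ (1 / q) :=
        Real.rpow_lt_rpow (Finset.sum_nonneg fun i _ => Real.rpow_nonneg (hμ i) q) hlt
          (by positivity)
    _ = N := by rw [← Real.rpow_mul hN0.le, mul_one_div_cancel hq0.ne', Real.rpow_one]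

section Peierls

variable {n : Type*} [Fintype n] [DecidableEq n]

theorem trRPow_of_isHermitian {ρ : Matrix n n ℂ} (h : ρ.IsHermitian) (α : ℝ) :
    trRPow ρ α = ∑ i, h.eigenvalues i ^ α := dif_pos h

/-- The entries of `W * D * star W` for a real diagonal matrix `D`. -/
theorem mul_diagonal_mul_star_apply (W : Matrix n n ℂ) (c : n → ℝ) (i j : n) :
    (W * Matrix.diagonal (fun k => (c k : ℂ)) * star W) i j =
      ∑ k, (c k : ℂ) * (W i k * star (W j k)) := by
  rw [Matrix.mul_apply]
  refine Finset.sum_congr rfl fun k _ => ?_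
  rw [Matrix.mul_diagonal, Matrix.star_apply]
  ring

theorem sum_normSq_row_eq_one {W : Matrix n n ℂ} (hW : W * star W = 1) (i : n) :
    ∑ k, Complex.normSq (W i k) = 1 := by
  have h := congrFun (congrFun hW i) i
  rw [Matrix.mul_apply, Matrix.one_apply_eq] at h
  simp only [Matrix.star_apply, Complex.star_def, Complex.mul_conj] at h
  exact_mod_cast h

/-- Peierls' inequality for `x ↦ x ^ q`, with its equality case, for a diagonal matrix
conjugated by a unitary. -/
theorem sum_diag_rpow_le_and_eq_imp {W : Matrix n n ℂ} (hW : W * star W = 1)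
    (hW' : star W * W = 1) {c : n → ℝ} (hc : ∀ k, 0 ≤ c k) {q : ℝ} (hq : 1 < q) {M : Matrix n n ℂ}
    (hM : M = W * Matrix.diagonal (fun k => (c k : ℂ)) * star W) :
    ∑ i, (M i i).re ^ q ≤ ∑ k, c k ^ q ∧
      (∑ i, (M i i).re ^ q = ∑ k, c k ^ q →
        M = Matrix.diagonal (fun i => ((M i i).re : ℂ))) := by
  have hdiag : ∀ i, (M i i).re = ∑ k, Complex.normSq (W i k) • c k := by
    intro i
    rw [hM, mul_diagonal_mul_star_apply, Complex.re_sum]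
    refine Finset.sum_congr rfl fun k _ => ?_
    rw [Complex.star_def, Complex.mul_conj, ← Complex.ofReal_mul, Complex.ofReal_re, smul_eq_mul,
      mul_comm]
  have hcol : ∀ k, ∑ i, Complex.normSq (W i k) = 1 := by
    intro k
    have h := sum_normSq_row_eq_one (W := star W) (by rwa [star_star]) k
    simpa [Matrix.star_apply, Complex.normSq_conj] using h
  have hjensen : ∀ i, (M i i).re ^ q ≤ ∑ k, Complex.normSq (W i k) • c k ^ q := by
    intro i
    rw [hdiag]
    exact (convexOn_rpow hq.le).map_sum_le (fun k _ => Complex.normSq_nonneg _)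
      (sum_normSq_row_eq_one hW i) (fun k _ => hc k)
  have hswap : ∑ i, ∑ k, Complex.normSq (W i k) • c k ^ q = ∑ k, c k ^ q := by
    rw [Finset.sum_comm]
    refine Finset.sum_congr rfl fun k _ => ?_
    rw [← Finset.sum_smul, hcol, one_smul]
  refine ⟨hswap ▸ Finset.sum_le_sum fun i _ => hjensen i, fun heq => ?_⟩
  rw [← hswap, Finset.sum_eq_sum_iff_of_le fun i _ => hjensen i] at heq
  have hconst : ∀ i k, W i k ≠ 0 → c k = (M i i).re := by
    intro i k hk
    have h := heq i (Finset.mem_univ i)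
    rw [hdiag] at h ⊢
    have h' := ((strictConvexOn_rpow hq).map_sum_eq_iff_of_nonneg
      (fun k _ => Complex.normSq_nonneg (W i k)) (sum_normSq_row_eq_one hW i)
      (fun k _ => hc k)).1 h
    have hsum : ∑ k', Complex.normSq (W i k') • c k' = ∑ k', Complex.normSq (W i k') • c k := by
      refine Finset.sum_congr rfl fun k' _ => ?_
      by_cases hk' : W i k' = 0
      · simp [hk']
      · rw [h' (Finset.mem_univ k') (by simpa using hk') (Finset.mem_univ k) (by simpa using hk)]
    rw [hsum, ← Finset.sum_smul, sum_normSq_row_eq_one hW, one_smul]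
  ext i j
  have hij : M i j = ((M i i).re : ℂ) * (W * star W) i j := by
    conv_lhs => rw [hM, mul_diagonal_mul_star_apply]
    rw [Matrix.mul_apply, Finset.mul_sum]
    refine Finset.sum_congr rfl fun k _ => ?_
    rw [Matrix.star_apply]
    by_cases hk : W i k = 0
    · simp [hk]
    · rw [hconst i k hk]
  rw [hij, hW, Matrix.one_apply, Matrix.diagonal_apply]
  split_ifs <;> simp

/-- Peierls' inequality for `tr ρ ^ q`: the diagonal of `ρ` in any orthonormal basis has smaller
`q`-power sum, and equality forces `ρ` to be diagonal in that basis. -/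
theorem sum_diag_conj_rpow_le_trRPow {ρ : Matrix n n ℂ} (hρ : ρ.PosSemidef)
    {U : Matrix n n ℂ} (hU : U ∈ Matrix.unitaryGroup n ℂ) {q : ℝ} (hq : 1 < q) :
    ∑ i, ((star U * ρ * U) i i).re ^ q ≤ trRPow ρ q ∧
      (∑ i, ((star U * ρ * U) i i).re ^ q = trRPow ρ q →
        star U * ρ * U = Matrix.diagonal (fun i => (((star U * ρ * U) i i).re : ℂ))) := by
  rw [trRPow_of_isHermitian hρ.isHermitian]
  set V := (hρ.isHermitian.eigenvectorUnitary : Matrix n n ℂ)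
  have hVm : V ∈ Matrix.unitaryGroup n ℂ := hρ.isHermitian.eigenvectorUnitary.2
  have hWm : star U * V ∈ Matrix.unitaryGroup n ℂ := mul_mem (Unitary.star_mem hU) hVm
  refine sum_diag_rpow_le_and_eq_imp (W := star U * V) (Unitary.mul_star_self_of_mem hWm)
    (Unitary.star_mul_self_of_mem hWm) hρ.eigenvalues_nonneg hq ?_
  conv_lhs => rw [hρ.isHermitian.spectral_theorem, Unitary.conjStarAlgAut_apply]
  rw [star_mul, star_star]
  simp only [Matrix.mul_assoc]
  rfl

end Peierls

theorem trRPow_nonneg {n : Type*} [Fintype n] [DecidableEq n] {ρ : Matrix n n ℂ}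
    (h : ρ.PosSemidef) (α : ℝ) : 0 ≤ trRPow ρ α := by
  rw [trRPow_of_isHermitian h.isHermitian]
  exact Finset.sum_nonneg fun i _ => Real.rpow_nonneg (h.eigenvalues_nonneg i) α

/-- For real `q > 1`, `s > 0` with `q·s ≥ 1` and `d ≥ 1`, the map
`ρ ↦ (tr ρ^q)^s` is strictly convex on `d × d` density matrices; equivalently, the
unified-(q,s) entropy `S_{q,s}(ρ) = (1/((q-1)s))·(1 - (tr ρ^q)^s)` is strictly concave. -/
theorem unified_entropy_qs_strictly_concave
    {d : ℕ} (hd : 1 ≤ d) (q s : ℝ) (hq : 1 < q) (hs : 0 < s) (hqs : 1 ≤ q * s)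
    (ρ₁ ρ₂ : Matrix (Fin d) (Fin d) ℂ)
    (h₁ : ρ₁.PosSemidef) (htr₁ : ρ₁.trace = 1)
    (h₂ : ρ₂.PosSemidef) (htr₂ : ρ₂.trace = 1)
    (hne : ρ₁ ≠ ρ₂) (l : ℝ) (hl0 : 0 < l) (hl1 : l < 1) :
    trRPow (l • ρ₁ + (1 - l) • ρ₂) q ^ s <
      l * trRPow ρ₁ q ^ s + (1 - l) * trRPow ρ₂ q ^ s ∧
    l * (1/((q-1)*s) * (1 - trRPow ρ₁ q ^ s))
        + (1 - l) * (1/((q-1)*s) * (1 - trRPow ρ₂ q ^ s)) <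
      1/((q-1)*s) * (1 - trRPow (l • ρ₁ + (1 - l) • ρ₂) q ^ s) := by
  have hq0 : 0 < q := by linarith
  have hl1' : 0 < 1 - l := by linarith
  have rpow_s : ∀ {x : ℝ}, 0 ≤ x → x ^ s = (x ^ (1 / q)) ^ (q * s) := by
    intro x hx
    rw [← Real.rpow_mul hx, ← mul_assoc, one_div_mul_cancel hq0.ne', one_mul]
  have hx₁ := trRPow_nonneg h₁ q
  have hx₂ := trRPow_nonneg h₂ q
  have hxσ := trRPow_nonneg ((h₁.smul hl0.le).add (h₂.smul hl1'.le)) q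
  have hmain : trRPow (l • ρ₁ + (1 - l) • ρ₂) q ^ s <
      l * trRPow ρ₁ q ^ s + (1 - l) * trRPow ρ₂ q ^ s := by
    rw [rpow_s hx₁, rpow_s hx₂, rpow_s hxσ]
    refine (Real.rpow_lt_rpow (Real.rpow_nonneg hxσ _)
      (trRPow_rpow_convexComb_lt hq h₁ htr₁ h₂ htr₂ hne hl0 hl1) (by positivity)).trans_le ?_
    exact (convexOn_rpow hqs).2 (Real.rpow_nonneg hx₁ _) (Real.rpow_nonneg hx₂ _)
      hl0.le hl1'.le (by ring)
  refine ⟨hmain, ?_⟩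
  have hc : 0 < 1 / ((q - 1) * s) := one_div_pos.2 (mul_pos (by linarith) hs)
  linear_combination (1 / ((q - 1) * s)) * hmain
end

section
/- Let q > 1 and s > 0 be real numbers with q·s ≥ 1. For any bipartite density matrix ρ_{AB} on ℂ^{d_A} ⊗ ℂ^{d_B} with reduced density matrices ρ_A and ρ_B, one has 1 + (tr ρ_{AB}^q)^s ≥ (tr ρ_A^q)^s + (tr ρ_B^q)^s, and equality holds if and only if ρ_A is pure or ρ_B is pure (i.e., tr ρ_A² = 1 or tr ρ_B² = 1). -/
open scoped Kronecker Matrix ComplexOrder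

/-- For exponents at least one, `a + b ≤ 1 + c` passes to powers of numbers in the unit interval. -/
lemma rpow_add_rpow_le_one_add_rpow {a b c t : ℝ} (ha0 : 0 ≤ a) (ha1 : a ≤ 1) (hb0 : 0 ≤ b)
    (hb1 : b ≤ 1) (hc0 : 0 ≤ c) (ht : 1 ≤ t) (h : a + b ≤ 1 + c) :
    a ^ t + b ^ t ≤ 1 + c ^ t ∧ (1 + c ^ t = a ^ t + b ^ t → a + b = 1 + c ∨ a = 1 ∨ b = 1) := by
  have ht0 : 0 < t := by linarith
  have eq_one {x : ℝ} (hx0 : 0 ≤ x) (hx : 1 ≤ x ^ t) (hx1 : x ≤ 1) : x = 1 := by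
    by_contra hne
    exact absurd hx (Real.rpow_lt_one hx0 (lt_of_le_of_ne hx1 hne) ht0).not_ge
  have ha := Real.rpow_le_one ha0 ha1 ht0.le
  have hb := Real.rpow_le_one hb0 hb1 ht0.le
  rcases le_or_gt b c with hbc | hcb
  · have hbc' := Real.rpow_le_rpow hb0 hbc ht0.le
    exact ⟨by linarith, fun e => .inr (.inl (eq_one ha0 (by linarith) ha1))⟩
  rcases le_or_gt a c with hac | hca
  · have hac' := Real.rpow_le_rpow ha0 hac ht0.le
    exact ⟨by linarith, fun e => .inr (.inr (eq_one hb0 (by linarith) hb1))⟩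
  have hc1 : 0 < 1 - c := by linarith
  have hmaj : (1 + c - b) ^ t + b ^ t ≤ 1 + c ^ t := by
    have hconv := (convexOn_rpow ht).2
    have hθ0 : 0 ≤ (b - c) / (1 - c) := div_nonneg (by linarith) hc1.le
    have hθ1 : 0 ≤ (1 - b) / (1 - c) := div_nonneg (by linarith) hc1.le
    have hsum : (b - c) / (1 - c) + (1 - b) / (1 - c) = 1 := by field_simp; ring
    have h₁ := hconv (Set.mem_Ici.2 zero_le_one) (Set.mem_Ici.2 hc0) hθ0 hθ1 hsum
    have h₂ := hconv (Set.mem_Ici.2 hc0) (Set.mem_Ici.2 zero_le_one) hθ0 hθ1 hsum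
    have e₁ : (b - c) / (1 - c) * 1 + (1 - b) / (1 - c) * c = b := by field_simp; ring
    have e₂ : (b - c) / (1 - c) * c + (1 - b) / (1 - c) * 1 = 1 + c - b := by field_simp; ring
    simp only [smul_eq_mul, Real.one_rpow] at h₁ h₂
    rw [e₁] at h₁
    rw [e₂] at h₂
    calc (1 + c - b) ^ t + b ^ t
        ≤ ((b - c) / (1 - c) + (1 - b) / (1 - c)) * (1 + c ^ t) := by linarith
      _ = 1 + c ^ t := by rw [hsum, one_mul]
  have hab : a ≤ 1 + c - b := by linarith
  have hmono := Real.rpow_le_rpow ha0 hab ht0.le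
  refine ⟨by linarith, fun e => .inl ?_⟩
  by_contra hne
  have := Real.rpow_lt_rpow ha0 (lt_of_le_of_ne hab fun h' => hne (by linarith)) ht0
  linarith

/-- The vector attaining the `ℓ^q` norm of a probability vector by Hölder duality. -/
lemma exists_lp_dual_vector {ι : Type*} [Fintype ι] {q : ℝ} (hq : 1 < q) {v : ι → ℝ}
    (hv : ∀ i, 0 ≤ v i) (hsum : ∑ i, v i = 1) :
    ∃ x : ι → ℝ, (∀ i, 0 ≤ x i) ∧ (∀ i, x i ≤ 1) ∧
      ∑ i, v i * x i = (∑ i, v i ^ q) ^ (1 / q) ∧ ∑ i, x i ^ q.conjExponent = 1 ∧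
      ((∃ i, v i = 1) ∨ ∀ i, x i < 1) := by
  classical
  have hq0 : 0 < q := by linarith
  have hq1 : 0 < q - 1 := by linarith
  set S := ∑ i, v i ^ q with hS
  have hSpos : 0 < S := by
    obtain ⟨i, -, hi⟩ := Finset.exists_ne_zero_of_sum_ne_zero (hsum.trans_ne one_ne_zero)
    exact Finset.sum_pos' (fun i _ => Real.rpow_nonneg (hv i) q)
      ⟨i, Finset.mem_univ i, Real.rpow_pos_of_pos ((hv i).lt_of_ne' hi) q⟩
  set a := S ^ (1 / q) with ha
  have hapos : 0 < a := Real.rpow_pos_of_pos hSpos _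
  have haq : a ^ q = S := by
    rw [ha, ← Real.rpow_mul hSpos.le, one_div_mul_cancel hq0.ne', Real.rpow_one]
  have hle (i) : v i ≤ a := by
    rw [← Real.rpow_le_rpow_iff (hv i) hapos.le hq0, haq]
    exact Finset.single_le_sum (f := fun i => v i ^ q)
      (fun j _ => Real.rpow_nonneg (hv j) q) (Finset.mem_univ i)
  have hdiv (i) : 0 ≤ v i / a := div_nonneg (hv i) hapos.le
  have hdiv1 (i) : v i / a ≤ 1 := (div_le_one hapos).2 (hle i)
  have hnorm : ∑ i, (v i / a) ^ q = 1 := by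
    simp_rw [Real.div_rpow (hv _) hapos.le, ← Finset.sum_div, haq]
    exact div_self hSpos.ne'
  refine ⟨fun i => (v i / a) ^ (q - 1), fun i => Real.rpow_nonneg (hdiv i) _,
    fun i => Real.rpow_le_one (hdiv i) (hdiv1 i) hq1.le, ?_, ?_, ?_⟩
  · have hterm (i) : v i * (v i / a) ^ (q - 1) = a * (v i / a) ^ q := by
      rcases (hv i).eq_or_lt with h0 | h0
      · simp [← h0, hq0.ne']
      · rw [Real.rpow_sub_one (div_pos h0 hapos).ne']
        field_simp
    simp_rw [hterm, ← Finset.mul_sum, hnorm, mul_one]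
  · have he : (q - 1) * q.conjExponent = q := by
      rw [Real.conjExponent]
      field_simp
    simp_rw [← Real.rpow_mul (hdiv _), he, hnorm]
  · by_contra! hcon
    obtain ⟨hne, i, hi⟩ := hcon
    have hvi : v i = a := by
      by_contra hlt
      exact absurd hi (Real.rpow_lt_one (hdiv i)
        ((div_lt_one hapos).2 ((hle i).lt_of_ne hlt)) hq1).not_ge
    have hother (j) (hj : j ≠ i) : v j = 0 := by
      have := Finset.sum_erase_add Finset.univ (fun i => v i ^ q) (Finset.mem_univ i)
      rw [hvi, haq, ← hS, add_eq_right, Finset.sum_eq_zero_iff_of_nonneg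
        fun j _ => Real.rpow_nonneg (hv j) q] at this
      exact ((Real.rpow_eq_zero (hv j) hq0.ne').1 (this j (by simp [hj])))
    exact hne i (by rw [← hsum, Finset.sum_eq_single i (fun j _ => hother j) (by simp)])

/-- Subadditivity of the `ℓ^q` norms of the marginals of a joint distribution. -/
lemma lp_norm_marginals_le {ι κ : Type*} [Fintype ι] [Fintype κ] {q : ℝ} (hq : 1 < q)
    {p : ι × κ → ℝ} (hp : ∀ m, 0 ≤ p m) {v : ι → ℝ} {w : κ → ℝ} (hv : ∀ i, ∑ k, p (i, k) = v i)
    (hw : ∀ k, ∑ i, p (i, k) = w k) (hsum : ∑ m, p m = 1) :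
    (∑ i, v i ^ q) ^ (1 / q) + (∑ k, w k ^ q) ^ (1 / q) ≤ 1 + (∑ m, p m ^ q) ^ (1 / q) ∧
      ((∑ i, v i ^ q) ^ (1 / q) + (∑ k, w k ^ q) ^ (1 / q) = 1 + (∑ m, p m ^ q) ^ (1 / q) →
        (∃ i, v i = 1) ∨ ∃ k, w k = 1) := by
  obtain ⟨x, hx0, hx1, hvx, hxq, hx⟩ := exists_lp_dual_vector hq (v := v)
    (fun i => hv i ▸ Finset.sum_nonneg fun k _ => hp _)
    (by rw [← hsum, Fintype.sum_prod_type]; simp_rw [hv])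
  obtain ⟨y, hy0, hy1, hwy, hyq, hy⟩ := exists_lp_dual_vector hq (v := w)
    (fun k => hw k ▸ Finset.sum_nonneg fun i _ => hp _)
    (by rw [← hsum, Fintype.sum_prod_type_right]; simp_rw [hw])
  have hholder : ∑ m : ι × κ, p m * (x m.1 * y m.2) ≤ (∑ m, p m ^ q) ^ (1 / q) := by
    refine (Real.inner_le_Lp_mul_Lq_of_nonneg Finset.univ (Real.HolderConjugate.conjExponent hq)
      (fun m _ => hp m) (fun m _ => mul_nonneg (hx0 m.1) (hy0 m.2))).trans_eq ?_
    simp_rw [Real.mul_rpow (hx0 _) (hy0 _)]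
    rw [Fintype.sum_prod_type (fun m : ι × κ => x m.1 ^ q.conjExponent * _)]
    simp_rw [← Finset.mul_sum, hyq, mul_one, hxq, Real.one_rpow, mul_one]
  have hvx' : ∑ m : ι × κ, p m * x m.1 = (∑ i, v i ^ q) ^ (1 / q) := by
    rw [← hvx, Fintype.sum_prod_type]
    simp_rw [← hv, Finset.sum_mul]
  have hwy' : ∑ m : ι × κ, p m * y m.2 = (∑ k, w k ^ q) ^ (1 / q) := by
    rw [← hwy, Fintype.sum_prod_type_right]
    simp_rw [← hw, Finset.sum_mul]
  have hexpand : ∑ m : ι × κ, p m * ((1 - x m.1) * (1 - y m.2)) =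
      1 - (∑ i, v i ^ q) ^ (1 / q) - (∑ k, w k ^ q) ^ (1 / q)
        + ∑ m : ι × κ, p m * (x m.1 * y m.2) := by
    rw [← hvx', ← hwy', ← congrArg (· - _ - _ + _) hsum, ← Finset.sum_sub_distrib,
      ← Finset.sum_sub_distrib,
      ← Finset.sum_add_distrib]
    exact Finset.sum_congr rfl fun m _ => by ring
  have hnonneg (m : ι × κ) : 0 ≤ p m * ((1 - x m.1) * (1 - y m.2)) :=
    mul_nonneg (hp m) (mul_nonneg (sub_nonneg.2 (hx1 _)) (sub_nonneg.2 (hy1 _)))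
  have hnonneg' := Finset.sum_nonneg fun m (_ : m ∈ Finset.univ) => hnonneg m
  refine ⟨by linarith, fun heq => ?_⟩
  by_contra hcon
  obtain ⟨hcv, hcw⟩ := not_or.1 hcon
  have hxlt := hx.resolve_left hcv
  have hylt := hy.resolve_left hcw
  obtain ⟨m, -, hm⟩ := Finset.exists_ne_zero_of_sum_ne_zero (hsum.trans_ne one_ne_zero)
  have : 0 < ∑ m : ι × κ, p m * ((1 - x m.1) * (1 - y m.2)) :=
    Finset.sum_pos' (fun m _ => hnonneg m) ⟨m, Finset.mem_univ m, mul_pos ((hp m).lt_of_ne' hm)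
      (mul_pos (sub_pos.2 (hxlt _)) (sub_pos.2 (hylt _)))⟩
  linarith

lemma eq_zero_of_sum_eq_one {ι : Type*} [Fintype ι] {v : ι → ℝ} (hv : ∀ i, 0 ≤ v i)
    (hsum : ∑ i, v i = 1) {i₀ : ι} (h₀ : v i₀ = 1) (i : ι) (hi : i ≠ i₀) : v i = 0 := by
  classical
  have := Finset.add_sum_erase Finset.univ v (Finset.mem_univ i₀)
  rw [h₀, hsum, add_eq_left, Finset.sum_eq_zero_iff_of_nonneg fun j _ => hv j] at this
  exact this i (by simp [hi])

lemma sum_rpow_le_one {ι : Type*} [Fintype ι] {q : ℝ} (hq : 1 ≤ q) {v : ι → ℝ}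
    (hv : ∀ i, 0 ≤ v i) (hsum : ∑ i, v i = 1) : ∑ i, v i ^ q ≤ 1 := by
  rw [← hsum]
  refine Finset.sum_le_sum fun i _ => Real.rpow_le_self_of_le_one (hv i) ?_ hq
  exact hsum ▸ Finset.single_le_sum (fun j _ => hv j) (Finset.mem_univ i)

lemma sum_rpow_eq_one_iff {ι : Type*} [Fintype ι] {q : ℝ} (hq : 1 < q) {v : ι → ℝ}
    (hv : ∀ i, 0 ≤ v i) (hsum : ∑ i, v i = 1) : ∑ i, v i ^ q = 1 ↔ ∃ i, v i = 1 := by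
  have hle (i) : v i ≤ 1 := hsum ▸ Finset.single_le_sum (fun j _ => hv j) (Finset.mem_univ i)
  constructor
  · intro h
    by_contra! hne
    obtain ⟨i, -, hi⟩ := Finset.exists_ne_zero_of_sum_ne_zero (hsum.trans_ne one_ne_zero)
    have := Finset.sum_lt_sum (s := Finset.univ) (f := fun i => v i ^ q) (g := v)
      (fun i _ => Real.rpow_le_self_of_le_one (hv i) (hle i) hq.le)
      ⟨i, Finset.mem_univ i, Real.rpow_lt_self_of_lt_one ((hv i).lt_of_ne' hi)
        ((hle i).lt_of_ne (hne i)) hq⟩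
    linarith
  · rintro ⟨i, hi⟩
    refine le_antisymm (sum_rpow_le_one hq.le hv hsum) ?_
    simpa [hi] using Finset.single_le_sum (f := fun i => v i ^ q)
      (fun j _ => Real.rpow_nonneg (hv j) q) (Finset.mem_univ i)

/-- The classical inequality behind subadditivity, for an upper bound `C` on the power sum of the
joint distribution. -/
lemma sum_rpow_marginals_le {ι κ : Type*} [Fintype ι] [Fintype κ] {q s : ℝ} (hq : 1 < q)
    (hqs : 1 ≤ q * s) {p : ι × κ → ℝ} (hp : ∀ m, 0 ≤ p m) {v : ι → ℝ} {w : κ → ℝ}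
    (hv : ∀ i, ∑ k, p (i, k) = v i) (hw : ∀ k, ∑ i, p (i, k) = w k) (hsum : ∑ m, p m = 1)
    {C : ℝ} (hC : ∑ m, p m ^ q ≤ C) :
    (∑ i, v i ^ q) ^ s + (∑ k, w k ^ q) ^ s ≤ 1 + C ^ s ∧
      (1 + C ^ s = (∑ i, v i ^ q) ^ s + (∑ k, w k ^ q) ^ s →
        (∃ i, v i = 1) ∨ ∃ k, w k = 1) := by
  have hq0 : 0 < q := by linarith
  have hs : 0 < s := pos_of_mul_pos_right (by linarith) hq0.le
  have hv0 (i) : 0 ≤ v i := hv i ▸ Finset.sum_nonneg fun k _ => hp _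
  have hw0 (k) : 0 ≤ w k := hw k ▸ Finset.sum_nonneg fun i _ => hp _
  have hv1 : ∑ i, v i = 1 := by rw [← hsum, Fintype.sum_prod_type]; simp_rw [hv]
  have hw1 : ∑ k, w k = 1 := by rw [← hsum, Fintype.sum_prod_type_right]; simp_rw [hw]
  have hV : 0 ≤ ∑ i, v i ^ q := Finset.sum_nonneg fun i _ => Real.rpow_nonneg (hv0 i) q
  have hW : 0 ≤ ∑ k, w k ^ q := Finset.sum_nonneg fun i _ => Real.rpow_nonneg (hw0 i) q
  have hP : 0 ≤ ∑ m, p m ^ q := Finset.sum_nonneg fun i _ => Real.rpow_nonneg (hp i) q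
  have hpow {x : ℝ} (hx : 0 ≤ x) : (x ^ (1 / q)) ^ (q * s) = x ^ s := by
    rw [← Real.rpow_mul hx, ← mul_assoc, one_div_mul_cancel hq0.ne', one_mul]
  have hroot {x : ℝ} (hx : 0 ≤ x) (h : x ^ (1 / q) = 1) : x = 1 := by
    exact (Real.rpow_left_inj hx zero_le_one (by positivity)).1 (h.trans (Real.one_rpow _).symm)
  have hlp := lp_norm_marginals_le hq hp hv hw hsum
  have hq1 : 0 ≤ 1 / q := by positivity
  have key := rpow_add_rpow_le_one_add_rpow (Real.rpow_nonneg hV (1 / q))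
    (Real.rpow_le_one hV (sum_rpow_le_one hq.le hv0 hv1) hq1) (Real.rpow_nonneg hW (1 / q))
    (Real.rpow_le_one hW (sum_rpow_le_one hq.le hw0 hw1) hq1) (Real.rpow_nonneg hP (1 / q))
    hqs hlp.1
  rw [hpow hV, hpow hW, hpow hP] at key
  have hPC := Real.rpow_le_rpow hP hC hs.le
  refine ⟨by linarith [key.1], fun heq => ?_⟩
  rcases key.2 (by linarith [key.1]) with h | h | h
  · exact hlp.2 h
  · exact .inl ((sum_rpow_eq_one_iff hq hv0 hv1).1 (hroot hV h))
  · exact .inr ((sum_rpow_eq_one_iff hq hw0 hw1).1 (hroot hW h))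

lemma Matrix.IsHermitian.conjTranspose_eigenvectorUnitary_mul_mul {n : Type*} [Fintype n]
    [DecidableEq n] {A : Matrix n n ℂ} (hA : A.IsHermitian) :
    (hA.eigenvectorUnitary : Matrix n n ℂ)ᴴ * A * (hA.eigenvectorUnitary : Matrix n n ℂ) =
      Matrix.diagonal fun i => (hA.eigenvalues i : ℂ) := by
  have := hA.conjStarAlgAut_star_eigenvectorUnitary
  rw [Unitary.conjStarAlgAut_apply] at this
  simpa [Matrix.star_eq_conjTranspose, Function.comp_def] using this

/-- Passing to the diagonal in another orthonormal basis decreases power sums. -/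
lemma sum_rpow_diag_le {n : Type*} [Fintype n] [DecidableEq n] {q : ℝ} (hq : 1 ≤ q)
    {V : Matrix n n ℂ} (hV : V ∈ Matrix.unitaryGroup n ℂ) {p r : n → ℝ}
    (hp : ∀ i, 0 ≤ p i)
    (hr : ∀ i, (r i : ℂ) = (Vᴴ * Matrix.diagonal (fun i => (p i : ℂ)) * V) i i) :
    ∑ i, r i ^ q ≤ ∑ i, p i ^ q := by
  have hrow (k) : ∑ i, Complex.normSq (V k i) = 1 := by
    have := congrFun₂ (Matrix.mem_unitaryGroup_iff.1 hV) k k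
    simp only [Matrix.mul_apply, Matrix.star_apply, Matrix.one_apply_eq, RCLike.star_def,
      Complex.mul_conj] at this
    exact_mod_cast this
  have hcol (i) : ∑ k, Complex.normSq (V k i) = 1 := by
    have := congrFun₂ (Matrix.mem_unitaryGroup_iff'.1 hV) i i
    simp only [Matrix.mul_apply, Matrix.star_apply, Matrix.one_apply_eq, RCLike.star_def,
      ← Complex.normSq_eq_conj_mul_self] at this
    exact_mod_cast this
  have hr' (i) : r i = ∑ k, Complex.normSq (V k i) * p k := by
    have := hr i
    rw [Matrix.mul_apply] at this
    simp only [Matrix.mul_diagonal, Matrix.conjTranspose_apply, RCLike.star_def] at this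
    have h2 (k) : (starRingEnd ℂ) (V k i) * p k * V k i =
        ((Complex.normSq (V k i) * p k : ℝ) : ℂ) := by
      rw [Complex.ofReal_mul, Complex.normSq_eq_conj_mul_self]
      ring
    simp_rw [h2] at this
    exact_mod_cast this
  calc ∑ i, r i ^ q ≤ ∑ i, ∑ k, Complex.normSq (V k i) * p k ^ q := by
        refine Finset.sum_le_sum fun i _ => ?_
        rw [hr' i]
        exact Real.rpow_arith_mean_le_arith_mean_rpow _ _ _ (fun k _ => Complex.normSq_nonneg _)
          (hcol i) (fun k _ => hp k) hq
    _ = ∑ k, p k ^ q := by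
        rw [Finset.sum_comm]
        simp_rw [← Finset.sum_mul, hrow, one_mul]

/-- Partial traces are covariant under local unitaries. -/
lemma sum_kronecker_conj_apply {m n : Type*} [Fintype m] [Fintype n] [DecidableEq n]
    (ρ : Matrix (m × n) (m × n) ℂ) (U : Matrix m m ℂ)
    {V : Matrix n n ℂ} (hV : V ∈ Matrix.unitaryGroup n ℂ) (i i' : m) :
    ∑ k, ((U ⊗ₖ V)ᴴ * ρ * (U ⊗ₖ V)) (i, k) (i', k) =
      (Uᴴ * Matrix.of (fun i i' => ∑ k, ρ (i, k) (i', k)) * U) i i' := by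
  have hrow (d b) : ∑ k, V d k * star (V b k) = if d = b then 1 else 0 := by
    simpa [Matrix.mul_apply, Matrix.one_apply] using
      congrFun₂ (Matrix.mem_unitaryGroup_iff.1 hV) d b
  calc ∑ k, ((U ⊗ₖ V)ᴴ * ρ * (U ⊗ₖ V)) (i, k) (i', k)
      = ∑ k, ∑ c, ∑ d, ∑ a, ∑ b,
          star (U a i) * ρ (a, b) (c, d) * U c i' * (V d k * star (V b k)) := by
        simp only [Matrix.mul_apply, Fintype.sum_prod_type, Finset.sum_mul,
          Matrix.conjTranspose_apply, Matrix.kroneckerMap_apply, star_mul']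
        congr! 5
        ring
    _ = ∑ c, ∑ d, ∑ a, ∑ b,
          star (U a i) * ρ (a, b) (c, d) * U c i' * ∑ k, V d k * star (V b k) := by
        simp only [Finset.mul_sum]
        rw [Finset.sum_comm]; congr! 1
        rw [Finset.sum_comm]; congr! 1
        rw [Finset.sum_comm]; congr! 1
        rw [Finset.sum_comm]
    _ = _ := by
        simp only [hrow, Matrix.mul_apply, Matrix.conjTranspose_apply, Matrix.of_apply,
          Finset.sum_mul, Finset.mul_sum, mul_ite, mul_one, mul_zero, Finset.sum_ite_eq,
          Finset.mem_univ, if_true]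
        congr! 1
        rw [Finset.sum_comm]

lemma sum_kronecker_conj_apply_left {m n : Type*} [Fintype m] [Fintype n] [DecidableEq m]
    (ρ : Matrix (m × n) (m × n) ℂ) {U : Matrix m m ℂ}
    (hU : U ∈ Matrix.unitaryGroup m ℂ) (V : Matrix n n ℂ) (k k' : n) :
    ∑ i, ((U ⊗ₖ V)ᴴ * ρ * (U ⊗ₖ V)) (i, k) (i, k') =
      (Vᴴ * Matrix.of (fun k k' => ∑ i, ρ (i, k) (i, k')) * V) k k' := by
  have h := sum_kronecker_conj_apply (ρ.submatrix Prod.swap Prod.swap) V hU k k'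
  have hswap : V ⊗ₖ U = (U ⊗ₖ V).submatrix (Equiv.prodComm n m) (Equiv.prodComm n m) := by
    ext ⟨a, b⟩ ⟨c, d⟩
    simp [mul_comm]
  have hρ : ρ.submatrix Prod.swap Prod.swap =
    ρ.submatrix (Equiv.prodComm n m) (Equiv.prodComm n m) := rfl
  rw [hswap, hρ, Matrix.conjTranspose_submatrix, Matrix.submatrix_mul_equiv,
    Matrix.submatrix_mul_equiv] at h
  exact h

lemma Matrix.PosSemidef.apply_eq_zero_of_diag_eq_zero {n : Type*} [Fintype n] {A : Matrix n n ℂ}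
    (hA : A.PosSemidef) {j : n} (hj : A j j = 0) (i : n) : A i j = 0 := by
  classical
  have h := (hA.dotProduct_mulVec_zero_iff (Pi.single j 1)).1 (by
    simp [hj])
  simpa [Matrix.mulVec_single_one] using congrFun h i

/-- A bipartite positive semidefinite matrix supported on a single row block, whose other partial
trace is diagonal, is itself diagonal. -/
lemma Matrix.PosSemidef.isDiag_of_support {m n : Type*} [Fintype m] [Fintype n]
    {σ : Matrix (m × n) (m × n) ℂ} (hσ : σ.PosSemidef) {i₀ : m}
    (h₀ : ∀ i ≠ i₀, ∀ k, σ (i, k) (i, k) = 0)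
    (hd : ∀ k k', k ≠ k' → ∑ i, σ (i, k) (i, k') = 0) : σ.IsDiag := by
  have hcol {i} (hi : i ≠ i₀) (x k) : σ x (i, k) = 0 :=
    hσ.apply_eq_zero_of_diag_eq_zero (h₀ i hi k) x
  rintro ⟨i, k⟩ ⟨i', k'⟩ hne
  by_cases hi' : i' = i₀
  · by_cases hi : i = i₀
    · subst hi hi'
      have := hd k k' fun h => hne (by rw [h])
      rwa [Finset.sum_eq_single i' (fun j _ hj => hcol hj _ _) (by simp)] at this
    · rw [← hσ.isHermitian.apply, hcol hi, star_zero]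
  · exact hcol hi' _ _

/-- **Lemma 2.** For `q > 1`, `s > 0` with `q·s ≥ 1` and a bipartite
density matrix `ρ` with reduced states `ρ_A`, `ρ_B`:
`1 + (tr ρ^q)^s ≥ (tr ρ_A^q)^s + (tr ρ_B^q)^s`, with equality iff `ρ_A` or `ρ_B`
is pure. -/
theorem unified_qs_subadditive
    {dA dB : ℕ} (q s : ℝ) (hq : 1 < q) (hs : 0 < s) (hqs : 1 ≤ q * s)
    (ρ : Matrix (Fin dA × Fin dB) (Fin dA × Fin dB) ℂ)
    (hρ : ρ.PosSemidef) (htr : ρ.trace = 1) :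
    let ρA : Matrix (Fin dA) (Fin dA) ℂ := Matrix.of fun i i' => ∑ k, ρ (i, k) (i', k)
    let ρB : Matrix (Fin dB) (Fin dB) ℂ := Matrix.of fun k k' => ∑ i, ρ (i, k) (i, k')
    trRPow ρA q ^ s + trRPow ρB q ^ s ≤ 1 + trRPow ρ q ^ s ∧
      (1 + trRPow ρ q ^ s = trRPow ρA q ^ s + trRPow ρB q ^ s ↔
        trRPow ρA 2 = 1 ∨ trRPow ρB 2 = 1) := by
  intro ρA ρB
  have hA : ρA.IsHermitian := by
    ext i i'
    simp [ρA, hρ.isHermitian.apply]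
  have hB : ρB.IsHermitian := by
    ext k k'
    simp [ρB, hρ.isHermitian.apply]
  have hH := hρ.isHermitian
  set U := (hA.eigenvectorUnitary : Matrix (Fin dA) (Fin dA) ℂ)
  set V := (hB.eigenvectorUnitary : Matrix (Fin dB) (Fin dB) ℂ)
  set R := (hH.eigenvectorUnitary : Matrix (Fin dA × Fin dB) (Fin dA × Fin dB) ℂ)
  have hU : U ∈ Matrix.unitaryGroup _ ℂ := hA.eigenvectorUnitary.2
  have hV : V ∈ Matrix.unitaryGroup _ ℂ := hB.eigenvectorUnitary.2
  have hR : R ∈ Matrix.unitaryGroup _ ℂ := hH.eigenvectorUnitary.2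
  have hW : U ⊗ₖ V ∈ Matrix.unitaryGroup _ ℂ := Matrix.kronecker_mem_unitary hU hV
  set W := U ⊗ₖ V
  set σ := Wᴴ * ρ * W with hσdef
  have hσ : σ.PosSemidef := hρ.conjTranspose_mul_mul_same W
  set p : Fin dA × Fin dB → ℝ := fun x => (σ x x).re
  have hpσ (x) : (p x : ℂ) = σ x x := by
    refine Complex.ext rfl ?_
    simpa using (Complex.nonneg_iff.1 (hσ.diag_nonneg (i := x))).2
  have hp (x) : 0 ≤ p x := (Complex.nonneg_iff.1 (hσ.diag_nonneg (i := x))).1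
  have hσA (i i') : ∑ k, σ (i, k) (i', k) =
      Matrix.diagonal (fun i => (hA.eigenvalues i : ℂ)) i i' := by
    rw [← hA.conjTranspose_eigenvectorUnitary_mul_mul]
    exact sum_kronecker_conj_apply ρ U hV i i'
  have hσB (k k') : ∑ i, σ (i, k) (i, k') =
      Matrix.diagonal (fun k => (hB.eigenvalues k : ℂ)) k k' := by
    rw [← hB.conjTranspose_eigenvectorUnitary_mul_mul]
    exact sum_kronecker_conj_apply_left ρ hU V k k'
  have hpA (i) : ∑ k, p (i, k) = hA.eigenvalues i := by
    have := hσA i i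
    simp only [← hpσ, Matrix.diagonal_apply_eq] at this
    exact_mod_cast this
  have hpB (k) : ∑ i, p (i, k) = hB.eigenvalues k := by
    have := hσB k k
    simp only [← hpσ, Matrix.diagonal_apply_eq] at this
    exact_mod_cast this
  have hW' : W * Wᴴ = 1 := Matrix.mem_unitaryGroup_iff.1 hW
  have hR' : R * Rᴴ = 1 := Matrix.mem_unitaryGroup_iff.1 hR
  have hsum : ∑ x, p x = 1 := by
    have : σ.trace = 1 := by
      rw [hσdef, Matrix.trace_mul_comm, ← mul_assoc, hW', one_mul, htr]
    rw [Matrix.trace] at this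
    simp only [Matrix.diag_apply, ← hpσ] at this
    exact_mod_cast this
  have hspec : Rᴴ * ρ * R = Matrix.diagonal fun x => (hH.eigenvalues x : ℂ) :=
    hH.conjTranspose_eigenvectorUnitary_mul_mul
  have hρW : ρ = W * σ * Wᴴ := by
    rw [hσdef, ← mul_assoc, ← mul_assoc, hW', one_mul, mul_assoc, hW', mul_one]
  have hρR : ρ = R * (Rᴴ * ρ * R) * Rᴴ := by
    rw [← mul_assoc, ← mul_assoc, hR', one_mul, mul_assoc, hR', mul_one]
  have hRW : Rᴴ * W ∈ Matrix.unitaryGroup _ ℂ := mul_mem (Unitary.star_mem hR) hW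
  have hWR : Wᴴ * R ∈ Matrix.unitaryGroup _ ℂ := mul_mem (Unitary.star_mem hW) hR
  have hpinch : ∑ x, p x ^ q ≤ ∑ x, hH.eigenvalues x ^ q := by
    refine sum_rpow_diag_le hq.le hRW hρ.eigenvalues_nonneg fun x => ?_
    rw [hpσ, ← hspec, hσdef]
    conv_lhs => rw [hρR]
    simp only [Matrix.conjTranspose_mul, Matrix.conjTranspose_conjTranspose, mul_assoc]
  have hdiag (hd : σ.IsDiag) : ∑ x, hH.eigenvalues x ^ q = ∑ x, p x ^ q := by
    refine le_antisymm (sum_rpow_diag_le hq.le hWR hp fun x => ?_) hpinch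
    have hσp : Matrix.diagonal (fun x => (p x : ℂ)) = σ := by
      simp_rw [hpσ]
      exact hd.diagonal_diag
    have := congrFun₂ hspec x x
    rw [Matrix.diagonal_apply_eq] at this
    rw [hσp, ← this]
    conv_lhs => rw [hρW]
    simp only [Matrix.conjTranspose_mul, Matrix.conjTranspose_conjTranspose, mul_assoc]
  have hA0 (i) : 0 ≤ hA.eigenvalues i := hpA i ▸ Finset.sum_nonneg fun k _ => hp _
  have hB0 (k) : 0 ≤ hB.eigenvalues k := hpB k ▸ Finset.sum_nonneg fun i _ => hp _
  have hA1 : ∑ i, hA.eigenvalues i = 1 := by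
    rw [← hsum, Fintype.sum_prod_type]; simp_rw [hpA]
  have hB1 : ∑ k, hB.eigenvalues k = 1 := by
    rw [← hsum, Fintype.sum_prod_type_right]; simp_rw [hpB]
  have hp_zero {x} (h : p x = 0) : σ x x = 0 := by rw [← hpσ, h, Complex.ofReal_zero]
  simp only [trRPow, dif_pos hA, dif_pos hB, dif_pos hH]
  have key := sum_rpow_marginals_le hq hqs hp hpA hpB hsum hpinch
  rw [sum_rpow_eq_one_iff one_lt_two hA0 hA1, sum_rpow_eq_one_iff one_lt_two hB0 hB1]
  refine ⟨key.1, key.2, ?_⟩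
  rintro (⟨i₀, h₀⟩ | ⟨k₀, h₀⟩)
  · have hrow (i) (hi : i ≠ i₀) (k) : p (i, k) = 0 :=
      (Finset.sum_eq_zero_iff_of_nonneg fun k _ => hp (i, k)).1
        ((hpA i).trans (eq_zero_of_sum_eq_one hA0 hA1 h₀ i hi)) k (Finset.mem_univ k)
    have hd : σ.IsDiag := hσ.isDiag_of_support (fun i hi k => hp_zero (hrow i hi k))
      fun k k' hk => by rw [hσB, Matrix.diagonal_apply_ne _ hk]
    have hcol (k) : p (i₀, k) = hB.eigenvalues k := by
      rw [← hpB, Finset.sum_eq_single i₀ (fun i _ hi => hrow i hi k) (by simp)]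
    rw [hdiag hd, (sum_rpow_eq_one_iff hq hA0 hA1).2 ⟨i₀, h₀⟩, Real.one_rpow,
      Fintype.sum_prod_type, Finset.sum_eq_single i₀ ?_ (by simp)]
    · simp_rw [hcol]
    · intro i _ hi
      simp [hrow i hi, (zero_lt_one.trans hq).ne']
  · have hcol (k) (hk : k ≠ k₀) (i) : p (i, k) = 0 :=
      (Finset.sum_eq_zero_iff_of_nonneg fun i _ => hp (i, k)).1
        ((hpB k).trans (eq_zero_of_sum_eq_one hB0 hB1 h₀ k hk)) i (Finset.mem_univ i)
    have hd' := (hσ.submatrix Prod.swap).isDiag_of_support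
      (fun k hk i => hp_zero (hcol k hk i))
      fun i i' hi => (hσA i i').trans (Matrix.diagonal_apply_ne _ hi)
    have hd : σ.IsDiag := by simpa using hd'.submatrix Prod.swap_injective
    have hrow (i) : p (i, k₀) = hA.eigenvalues i := by
      rw [← hpA, Finset.sum_eq_single k₀ (fun k _ hk => hcol k hk i) (by simp)]
    rw [hdiag hd, (sum_rpow_eq_one_iff hq hB0 hB1).2 ⟨k₀, h₀⟩, Real.one_rpow, add_comm,
      Fintype.sum_prod_type_right, Finset.sum_eq_single k₀ ?_ (by simp)]
    · simp_rw [hrow]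
    · intro k _ hk
      simp [hcol k hk, (zero_lt_one.trans hq).ne']
end

section
/- Let p > 1 be a real number and let a, b, c be real numbers with 0 < a ≤ 1, 0 < b ≤ 1, 0 < c ≤ 1 and 1 + a ≥ b + c. Then 1 + a^p ≥ b^p + c^p; moreover, if 1 + a^p = b^p + c^p then b = 1 or c = 1. -/
open scoped Kronecker Matrix ComplexOrder

/-- If `b, c < 1` and `b + c ≤ 1 + a`, then strict convexity of `x ↦ x ^ p` gives
`b ^ p + c ^ p < 1 + a ^ p`. -/
lemma rpow_add_rpow_lt_one_add_rpow {p a b c : ℝ} (hp : 1 < p) (ha0 : 0 ≤ a) (ha1 : a ≤ 1)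
    (hb0 : 0 ≤ b) (hb1 : b < 1) (hc0 : 0 ≤ c) (hc1 : c < 1) (habc : b + c ≤ 1 + a) :
    b ^ p + c ^ p < 1 + a ^ p := by
  have hp0 : 0 < p := by linarith
  rcases le_or_gt b a with hba | hab
  · linarith [Real.rpow_le_rpow hb0 hba hp0.le, Real.rpow_lt_one hc0 hc1 hp0]
  rcases le_or_gt c a with hca | hac
  · linarith [Real.rpow_le_rpow hc0 hca hp0.le, Real.rpow_lt_one hb0 hb1 hp0]
  have chord : ∀ {y : ℝ}, a < y → y < 1 →
      (1 - a) * y ^ p < (1 - y) * a ^ p + (y - a) := fun hay hy1 => by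
    simpa using (strictConvexOn_rpow hp).secant_strict_mono_aux1
      (Set.mem_Ici.2 ha0) (Set.mem_Ici.2 zero_le_one) hay hy1
  have hslack : 0 ≤ (1 + a - (b + c)) * (1 - a ^ p) :=
    mul_nonneg (by linarith) (by linarith [Real.rpow_le_one ha0 ha1 hp0.le])
  refine lt_of_mul_lt_mul_left ?_ (by linarith : 0 ≤ 1 - a)
  linarith [chord hab hb1, chord hac hc1]

/-- For real `p > 1` and `0 < a, b, c ≤ 1` with `1 + a ≥ b + c`:
`1 + a^p ≥ b^p + c^p`, and if equality holds then `b = 1` or `c = 1`. -/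
theorem one_add_rpow_ge_rpow_add_rpow
    (p a b c : ℝ) (hp : 1 < p)
    (ha0 : 0 < a) (ha1 : a ≤ 1) (hb0 : 0 < b) (hb1 : b ≤ 1)
    (hc0 : 0 < c) (hc1 : c ≤ 1) (habc : b + c ≤ 1 + a) :
    b ^ p + c ^ p ≤ 1 + a ^ p ∧
      (1 + a ^ p = b ^ p + c ^ p → b = 1 ∨ c = 1) := by
  have hp0 : 0 ≤ p := by linarith
  rcases hb1.eq_or_lt with rfl | hb
  · have := Real.rpow_le_rpow hc0.le (by linarith : c ≤ a) hp0
    exact ⟨by rw [Real.one_rpow]; linarith, fun _ => Or.inl rfl⟩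
  rcases hc1.eq_or_lt with rfl | hc
  · have := Real.rpow_le_rpow hb0.le (by linarith : b ≤ a) hp0
    exact ⟨by rw [Real.one_rpow]; linarith, fun _ => Or.inr rfl⟩
  have hlt := rpow_add_rpow_lt_one_add_rpow hp ha0.le ha1 hb0.le hb hc0.le hc habc
  exact ⟨hlt.le, fun h => absurd h hlt.ne'⟩
end

section
/- Let q > 1 and s > 0 be real numbers and let ρ be a density matrix on ℂ^d that is not pure (i.e., tr ρ² < 1). Then q·((tr ρ^{1/q})^{1/s} − 1) > 1 − (tr ρ^q)^{1/s}. -/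
open scoped Kronecker Matrix ComplexOrder

/-- Log-convexity of `α ↦ ∑ i, p i ^ α` between the exponents `1/q`, `1` and `q`, for a probability
vector `p`. -/
theorem log_sum_rpow_add_nonneg {ι : Type*} [Fintype ι] {p : ι → ℝ} {q : ℝ} (hq : 0 < q)
    (hp : ∀ i, 0 ≤ p i) (hsum : ∑ i, p i = 1) (hA : 0 < ∑ i, p i ^ (1 / q))
    (hB : 0 < ∑ i, p i ^ q) :
    0 ≤ q * Real.log (∑ i, p i ^ (1 / q)) + Real.log (∑ i, p i ^ q) := by
  have hq1 : 0 < q + 1 := by linarith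
  have hconj : ((q + 1) / q).HolderConjugate (q + 1) := by
    rw [Real.holderConjugate_iff]
    refine ⟨by rw [lt_div_iff₀ hq]; linarith, by field_simp⟩
  have holder := Real.inner_le_Lp_mul_Lq_of_nonneg Finset.univ hconj
    (f := fun i => p i ^ (1 / (q + 1))) (g := fun i => p i ^ (q / (q + 1)))
    (fun i _ => Real.rpow_nonneg (hp i) _) (fun i _ => Real.rpow_nonneg (hp i) _)
  have hfg (i : ι) : p i ^ (1 / (q + 1)) * p i ^ (q / (q + 1)) = p i := by
    have hexp : 1 / (q + 1) + q / (q + 1) = 1 := by field_simp; ring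
    rw [← Real.rpow_add' (hp i) (by rw [hexp]; exact one_ne_zero), hexp, Real.rpow_one]
  have hf (i : ι) : (p i ^ (1 / (q + 1))) ^ ((q + 1) / q) = p i ^ (1 / q) := by
    rw [← Real.rpow_mul (hp i)]; congr 1; field_simp
  have hg (i : ι) : (p i ^ (q / (q + 1))) ^ (q + 1) = p i ^ q := by
    rw [← Real.rpow_mul (hp i)]; congr 1; field_simp
  simp only [hfg, hf, hg, hsum] at holder
  have hlog := Real.log_nonneg holder
  rw [Real.log_mul (Real.rpow_pos_of_pos hA _).ne' (Real.rpow_pos_of_pos hB _).ne',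
    Real.log_rpow hA, Real.log_rpow hB] at hlog
  have := mul_nonneg hq1.le hlog
  field_simp at this
  linarith

/-- If `A > 1`, `B > 0` and `A ^ q * B ≥ 1` (in logarithmic form), then
`1 - B ^ t < q * (A ^ t - 1)` for every `t > 0`. -/
theorem one_sub_rpow_lt_of_log_nonneg {A B q t : ℝ} (hq : 0 < q) (ht : 0 < t) (hA : 1 < A)
    (hB : 0 < B) (h : 0 ≤ q * Real.log A + Real.log B) :
    1 - B ^ t < q * (A ^ t - 1) := by
  have hA0 : 0 < A := by linarith
  have hlogA := Real.log_lt_sub_one_of_pos (Real.rpow_pos_of_pos hA0 t)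
    (Real.one_lt_rpow hA ht).ne'
  have hlogB := Real.log_le_sub_one_of_pos (Real.rpow_pos_of_pos hB t)
  rw [Real.log_rpow hA0] at hlogA
  rw [Real.log_rpow hB] at hlogB
  nlinarith [mul_nonneg ht.le h, mul_lt_mul_of_pos_left hlogA hq]

/-- The inequality for a probability vector that is not a point mass. -/
theorem one_sub_sum_rpow_lt {ι : Type*} [Fintype ι] {p : ι → ℝ} {q t : ℝ} (hq : 1 < q)
    (ht : 0 < t) (hp : ∀ i, 0 ≤ p i) (hsum : ∑ i, p i = 1)
    (hmixed : ∑ i, p i ^ (2 : ℝ) < 1) :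
    1 - (∑ i, p i ^ q) ^ t < q * ((∑ i, p i ^ (1 / q)) ^ t - 1) := by
  have hq0 : 0 < q := by linarith
  have hinv : 1 / q < 1 := by rw [div_lt_one hq0]; exact hq
  have hle (i : ι) : p i ≤ 1 :=
    hsum ▸ Finset.single_le_sum (fun j _ => hp j) (Finset.mem_univ i)
  obtain ⟨k, -, hk⟩ := Finset.exists_lt_of_sum_lt (hmixed.trans_eq hsum.symm)
  rw [Real.rpow_two] at hk
  have hk0 : 0 < p k := (sq_nonneg _).trans_lt hk
  have hk1 : p k < 1 := by nlinarith
  have hA : 1 < ∑ i, p i ^ (1 / q) := by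
    refine hsum.symm.trans_lt (Finset.sum_lt_sum (fun i _ => ?_) ⟨k, Finset.mem_univ k, ?_⟩)
    · exact Real.self_le_rpow_of_le_one (hp i) (hle i) hinv.le
    · exact Real.self_lt_rpow_of_lt_one hk0 hk1 hinv
  have hB : 0 < ∑ i, p i ^ q :=
    Finset.sum_pos' (fun i _ => Real.rpow_nonneg (hp i) _)
      ⟨k, Finset.mem_univ k, Real.rpow_pos_of_pos hk0 _⟩
  exact one_sub_rpow_lt_of_log_nonneg hq0 ht hA hB
    (log_sum_rpow_add_nonneg hq0 hp hsum (by linarith) hB)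

/-- For `q > 1`, `s > 0` and a non-pure density matrix `ρ`
(`tr ρ² < 1`): `q·((tr ρ^{1/q})^{1/s} - 1) > 1 - (tr ρ^q)^{1/s}`. -/
theorem q_mul_tr_rpow_gt
    {d : ℕ} (q s : ℝ) (hq : 1 < q) (hs : 0 < s)
    (ρ : Matrix (Fin d) (Fin d) ℂ) (hρ : ρ.PosSemidef) (htr : ρ.trace = 1)
    (hmixed : trRPow ρ 2 < 1) :
    1 - trRPow ρ q ^ (1/s) < q * (trRPow ρ (1/q) ^ (1/s) - 1) := by
  have hH : ρ.IsHermitian := hρ.1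
  have hsum : ∑ i, hH.eigenvalues i = 1 := by
    have h := hH.trace_eq_sum_eigenvalues
    rw [htr] at h
    apply Complex.ofReal_injective
    rw [Complex.ofReal_sum, Complex.ofReal_one]
    exact h.symm
  simp only [trRPow, dif_pos hH] at hmixed ⊢
  exact one_sub_sum_rpow_lt hq (one_div_pos.mpr hs) (fun i => hρ.eigenvalues_nonneg i) hsum hmixed
end

section
/- Let q ≥ s > 1 be real numbers. Let ψ be a bipartite pure state on ℂ^{d_A} ⊗ ℂ^{d_B} that is entangled, and let ρ = ρ_A be its reduced density matrix (so tr ρ² < 1). Then the following strict chain of inequalities holds between the unified entropy entanglements of ψ: (1 − (tr ρ^q)^s)/((q−1)·s) < s·(1 − (tr ρ^q)^{1/s})/(q−1) < q·s·((tr ρ^{1/q})^{1/s} − 1)/(q−1); that is, E_{q,s}(ψ) < E_{q,1/s}(ψ) < E_{1/q,1/s}(ψ). -/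
open scoped Kronecker Matrix ComplexOrder

/-- For a probability vector, an interpolation between the exponents `1/q` and `q`:
`q log ∑ pᵢ^{1/q} + log ∑ pᵢ^q ≥ 0`. -/
lemma log_sum_rpow_interpolation {ι : Type*} [Fintype ι] {p : ι → ℝ} (hp : ∀ i, 0 ≤ p i)
    (hsum : ∑ i, p i = 1) {q : ℝ} (hq : 0 < q) (hB : 0 < ∑ i, p i ^ (1 / q))
    (ha : 0 < ∑ i, p i ^ q) :
    0 ≤ q * Real.log (∑ i, p i ^ (1 / q)) + Real.log (∑ i, p i ^ q) := by
  have hq1 : 0 < q + 1 := by linarith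
  have hconj : ((q + 1) / q).HolderConjugate (q + 1) := by
    rw [Real.holderConjugate_iff]
    refine ⟨by rw [lt_div_iff₀ hq]; linarith, by field_simp⟩
  have hol := Real.inner_le_Lp_mul_Lq_of_nonneg Finset.univ hconj
    (f := fun i => p i ^ (1 / (q + 1))) (g := fun i => p i ^ (q / (q + 1)))
    (fun i _ => Real.rpow_nonneg (hp i) _) (fun i _ => Real.rpow_nonneg (hp i) _)
  have hfg : ∀ i, p i ^ (1 / (q + 1)) * p i ^ (q / (q + 1)) = p i := fun i => by
    rw [← Real.rpow_add_of_nonneg (hp i) (by positivity) (by positivity),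
      show 1 / (q + 1) + q / (q + 1) = 1 by field_simp; ring, Real.rpow_one]
  have hf : ∀ i, (p i ^ (1 / (q + 1))) ^ ((q + 1) / q) = p i ^ (1 / q) := fun i => by
    rw [← Real.rpow_mul (hp i)]
    congr 1
    field_simp
  have hg : ∀ i, (p i ^ (q / (q + 1))) ^ (q + 1) = p i ^ q := fun i => by
    rw [← Real.rpow_mul (hp i)]
    congr 1
    field_simp
  simp only [hfg, hf, hg, hsum] at hol
  have hlog := Real.log_nonneg hol
  rw [Real.log_mul (Real.rpow_pos_of_pos hB _).ne' (Real.rpow_pos_of_pos ha _).ne',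
    Real.log_rpow hB, Real.log_rpow ha] at hlog
  refine (mul_nonneg hq1.le hlog).trans_eq ?_
  generalize Real.log (∑ i, p i ^ (1 / q)) = u, Real.log (∑ i, p i ^ q) = v
  field_simp

lemma sum_rpow_pos {ι : Type*} [Fintype ι] {p : ι → ℝ} (hp : ∀ i, 0 ≤ p i)
    (hsum : ∑ i, p i = 1) (r : ℝ) : 0 < ∑ i, p i ^ r := by
  obtain ⟨i, -, hi⟩ := Finset.exists_lt_of_sum_lt
    (s := Finset.univ) (f := fun _ => (0 : ℝ)) (g := p) (by simp [hsum])
  exact Finset.sum_pos' (fun j _ => Real.rpow_nonneg (hp j) r)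
    ⟨i, Finset.mem_univ i, Real.rpow_pos_of_pos hi r⟩

lemma sum_rpow_lt_one {ι : Type*} [Fintype ι] {p : ι → ℝ} (hp : ∀ i, 0 ≤ p i)
    (hsum : ∑ i, p i = 1) (hsq : ∑ i, p i ^ (2 : ℝ) < 1) {q : ℝ} (hq : 1 < q) :
    ∑ i, p i ^ q < 1 := by
  have hle : ∀ i, p i ≤ 1 := fun i =>
    hsum ▸ Finset.single_le_sum (fun j _ => hp j) (Finset.mem_univ i)
  obtain ⟨i, -, hi⟩ := Finset.exists_lt_of_sum_lt
    (s := Finset.univ) (f := fun i => p i ^ (2 : ℝ)) (g := p) (by rwa [hsum])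
  have hi0 : 0 < p i := (hp i).lt_of_ne fun h => by simp [← h] at hi
  have hi1 : p i < 1 := (hle i).lt_of_ne fun h => by simp [h] at hi
  calc ∑ i, p i ^ q < ∑ i, p i := by
        refine Finset.sum_lt_sum (fun j _ => ?_) ⟨i, Finset.mem_univ i, ?_⟩
        · exact Real.rpow_le_self_of_le_one (hp j) (hle j) hq.le
        · simpa using Real.rpow_lt_rpow_of_exponent_gt hi0 hi1 hq
    _ = 1 := hsum

/-- The classical (probability vector) form of the chain of unified entropies. -/
lemma unified_entropy_chain {ι : Type*} [Fintype ι] {p : ι → ℝ} (hp : ∀ i, 0 ≤ p i)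
    (hsum : ∑ i, p i = 1) (hsq : ∑ i, p i ^ (2 : ℝ) < 1) {q s : ℝ} (hq : 1 < q) (hs : 1 < s) :
    (1 - (∑ i, p i ^ q) ^ s) / ((q - 1) * s)
        < s * (1 - (∑ i, p i ^ q) ^ (1 / s)) / (q - 1) ∧
      s * (1 - (∑ i, p i ^ q) ^ (1 / s)) / (q - 1)
        < q * s * ((∑ i, p i ^ (1 / q)) ^ (1 / s) - 1) / (q - 1) := by
  have hq0 : 0 < q - 1 := by linarith
  have hs0 : 0 < s := by linarith
  have ha := sum_rpow_pos hp hsum q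
  have hB := sum_rpow_pos hp hsum (1 / q)
  have ha1 := sum_rpow_lt_one hp hsum hsq hq
  have hint := log_sum_rpow_interpolation hp hsum (by linarith) hB ha
  set a := ∑ i, p i ^ q
  set B := ∑ i, p i ^ (1 / q)
  have hY0 : 0 < a ^ (1 / s) := Real.rpow_pos_of_pos ha _
  have hX0 : 0 < B ^ (1 / s) := Real.rpow_pos_of_pos hB _
  have hY1 : a ^ (1 / s) < 1 := Real.rpow_lt_one ha.le ha1 (by positivity)
  constructor
  · have hbern := one_add_mul_self_lt_rpow_one_add (s := a ^ (1 / s) - 1) (by linarith)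
      (by linarith) (p := s * s) (by nlinarith)
    rw [add_sub_cancel, ← Real.rpow_mul ha.le, show 1 / s * (s * s) = s by field_simp] at hbern
    rw [div_lt_div_iff₀ (by positivity) hq0]
    nlinarith
  · have hlogY := Real.log_lt_sub_one_of_pos hY0 hY1.ne
    have hlogX := Real.log_le_sub_one_of_pos hX0
    have hnonneg : 0 ≤ q * Real.log (B ^ (1 / s)) + Real.log (a ^ (1 / s)) := by
      rw [Real.log_rpow hB, Real.log_rpow ha]
      have := mul_nonneg (by positivity : 0 ≤ 1 / s) hint
      linarith
    have hmul := mul_le_mul_of_nonneg_left hlogX (by linarith : 0 ≤ q)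
    rw [mul_comm q s, mul_assoc]
    gcongr
    linarith

/-- **Proposition 1, pure-state case.** For `q ≥ s > 1` and an entangled
bipartite pure state `ψ` with reduced state `ρ = ρ_A` (so `tr ρ² < 1`):
`E_{q,s}(ψ) < E_{q,1/s}(ψ) < E_{1/q,1/s}(ψ)`. -/
theorem unified_entanglement_chain
    {dA dB : ℕ} (q s : ℝ) (hs : 1 < s) (hsq : s ≤ q)
    (ψ : Fin dA × Fin dB → ℂ) (hψ : ∑ x, ‖ψ x‖ ^ 2 = 1) :
    let ρ : Matrix (Fin dA) (Fin dA) ℂ :=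
      Matrix.of fun i i' => ∑ k, ψ (i, k) * (starRingEnd ℂ) (ψ (i', k))
    trRPow ρ 2 < 1 →
      (1 - trRPow ρ q ^ s) / ((q - 1) * s)
          < s * (1 - trRPow ρ q ^ (1/s)) / (q - 1) ∧
      s * (1 - trRPow ρ q ^ (1/s)) / (q - 1)
          < q * s * (trRPow ρ (1/q) ^ (1/s) - 1) / (q - 1) := by
  intro ρ hρ
  let M : Matrix (Fin dA) (Fin dB) ℂ := Matrix.of fun i k => ψ (i, k)
  have hM : ρ = M * Mᴴ := by
    ext i j
    simp [ρ, M, Matrix.mul_apply]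
  have hpsd : ρ.PosSemidef := hM ▸ Matrix.posSemidef_self_mul_conjTranspose M
  have hherm := hpsd.isHermitian
  have htrace : ρ.trace = 1 := by
    simp only [Matrix.trace, Matrix.diag, ρ, Matrix.of_apply, Complex.mul_conj']
    rw [← Fintype.sum_prod_type' (f := fun i k => (‖ψ (i, k)‖ : ℂ) ^ 2)]
    exact_mod_cast hψ
  have hsum : ∑ i, hherm.eigenvalues i = 1 := by
    have h := hherm.trace_eq_sum_eigenvalues
    rw [htrace] at h
    apply Complex.ofReal_injective
    simpa using h.symm
  simp only [trRPow, dif_pos hherm] at hρ ⊢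
  exact unified_entropy_chain hpsd.eigenvalues_nonneg hsum hρ (by linarith) hs
end

section
/- Let r and t be real numbers with 0 < r < 1 and 0 < t ≤ 1, and let ρ be a density matrix on ℂ^d that is not pure (i.e., tr ρ² < 1). Then the bipartite product density matrix σ = ρ ⊗ ρ (whose reduced density matrices both equal ρ) satisfies the strict inequality 1 + (tr σ^r)^t > (tr ρ^r)^t + (tr ρ^r)^t. In particular, the reduced function h_{r,t}(ρ) = ((tr ρ^r)^t − 1)/((1−r)t) of the unified-(r,t) entropy entanglement is not subadditive: h_{r,t}(σ) > h_{r,t}(ρ) + h_{r,t}(ρ). -/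
open scoped Kronecker Matrix ComplexOrder

namespace Matrix.IsHermitian

variable {m n : Type*} [Fintype m] [DecidableEq m] [Fintype n] [DecidableEq n]

/-- The eigenvalues of a Kronecker product of Hermitian matrices are the products of
the eigenvalues of the factors. -/
theorem charpoly_kronecker {A : Matrix m m ℂ} {B : Matrix n n ℂ}
    (hA : A.IsHermitian) (hB : B.IsHermitian) :
    (A ⊗ₖ B).charpoly = ∏ p : m × n,
      (Polynomial.X - Polynomial.C (((hA.eigenvalues p.1 * hB.eigenvalues p.2 : ℝ)) : ℂ)) := by
  have key : A ⊗ₖ B =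
      ((hA.eigenvectorUnitary : Matrix m m ℂ) ⊗ₖ (hB.eigenvectorUnitary : Matrix n n ℂ)) *
      Matrix.diagonal
        (fun p : m × n => ((hA.eigenvalues p.1 * hB.eigenvalues p.2 : ℝ) : ℂ)) *
      (star (hA.eigenvectorUnitary : Matrix m m ℂ) ⊗ₖ
        star (hB.eigenvectorUnitary : Matrix n n ℂ)) := by
    conv_lhs => rw [hA.spectral_theorem, hB.spectral_theorem]
    simp only [Unitary.conjStarAlgAut_apply, Matrix.mul_kronecker_mul,
      Matrix.diagonal_kronecker_diagonal]
    simp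
  rw [key, Matrix.charpoly_mul_comm, ← mul_assoc, ← Matrix.mul_kronecker_mul]
  simp [Matrix.charpoly_diagonal]

end Matrix.IsHermitian

/-- A Hermitian matrix whose characteristic polynomial splits with real roots `f i` has
`tr A^α = ∑ i, f i ^ α`. -/
theorem trRPow_eq_sum_of_charpoly_eq {n ι : Type*} [Fintype n] [DecidableEq n] [Fintype ι]
    {A : Matrix n n ℂ} (hA : A.IsHermitian) {f : ι → ℝ}
    (hf : A.charpoly = ∏ i, (Polynomial.X - Polynomial.C (f i : ℂ))) (α : ℝ) :
    trRPow A α = ∑ i, f i ^ α := by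
  have hroots := hA.roots_charpoly_eq_eigenvalues
  rw [hf, Polynomial.roots_prod _ _
    (by simp [Finset.prod_ne_zero_iff, Polynomial.X_sub_C_ne_zero])] at hroots
  have hsum := congrArg (fun s => (s.map fun z : ℂ => z.re ^ α).sum) hroots
  simp only [Polynomial.roots_X_sub_C, Multiset.bind_singleton, Multiset.map_map] at hsum
  rw [trRPow, dif_pos hA]
  exact hsum.symm

theorem trRPow_kronecker {m n : Type*} [Fintype m] [DecidableEq m] [Fintype n] [DecidableEq n]
    {A : Matrix m m ℂ} {B : Matrix n n ℂ} (hA : A.PosSemidef) (hB : B.PosSemidef) (α : ℝ) :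
    trRPow (A ⊗ₖ B) α = trRPow A α * trRPow B α := by
  rw [trRPow_eq_sum_of_charpoly_eq (hA.kronecker hB).isHermitian
      (hA.isHermitian.charpoly_kronecker hB.isHermitian),
    trRPow, trRPow, dif_pos hA.isHermitian, dif_pos hB.isHermitian,
    Finset.sum_mul_sum, Fintype.sum_prod_type]
  exact Finset.sum_congr rfl fun i _ => Finset.sum_congr rfl fun j _ =>
    Real.mul_rpow (hA.eigenvalues_nonneg i) (hB.eigenvalues_nonneg j)

/-- A probability vector with `∑ i, p i ^ 2 < 1` has `∑ i, p i ^ r > 1` for `r < 1`. -/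
theorem one_lt_sum_rpow_of_sum_sq_lt_one {ι : Type*} [Fintype ι] {p : ι → ℝ}
    (hp : ∀ i, 0 ≤ p i) (hsum : ∑ i, p i = 1) (hsq : ∑ i, p i ^ (2 : ℝ) < 1)
    {r : ℝ} (hr1 : r < 1) : 1 < ∑ i, p i ^ r := by
  have hle : ∀ i, p i ≤ 1 := fun i =>
    hsum ▸ Finset.single_le_sum (fun j _ => hp j) (Finset.mem_univ i)
  obtain ⟨i, -, hi⟩ : ∃ i ∈ Finset.univ, p i ^ (2 : ℝ) < p i :=
    Finset.exists_lt_of_sum_lt (by rwa [hsum])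
  have hi0 : 0 < p i := (Real.rpow_nonneg (hp i) 2).trans_lt hi
  have hi1 : p i < 1 := by
    refine (hle i).lt_of_ne fun h => ?_
    simp [h] at hi
  rw [← hsum]
  refine Finset.sum_lt_sum (fun j _ => ?_) ⟨i, Finset.mem_univ i, ?_⟩
  · exact Real.self_le_rpow_of_le_one (hp j) (hle j) hr1.le
  · exact Real.self_lt_rpow_of_lt_one hi0 hi1 hr1

theorem one_lt_trRPow {n : Type*} [Fintype n] [DecidableEq n] {ρ : Matrix n n ℂ}
    (hρ : ρ.PosSemidef) (htr : ρ.trace = 1) (hmixed : trRPow ρ 2 < 1)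
    {r : ℝ} (hr1 : r < 1) : 1 < trRPow ρ r := by
  rw [trRPow, dif_pos hρ.isHermitian] at hmixed ⊢
  refine one_lt_sum_rpow_of_sum_sq_lt_one hρ.eigenvalues_nonneg ?_ hmixed hr1
  rw [hρ.isHermitian.trace_eq_sum_eigenvalues] at htr
  simpa using congrArg Complex.re htr

/-- For `0 < r < 1`, `0 < t ≤ 1` and a non-pure density matrix `ρ`
(`tr ρ² < 1`), the product state `σ = ρ ⊗ ρ` satisfies
`1 + (tr σ^r)^t > (tr ρ^r)^t + (tr ρ^r)^t`; in particular the reduced function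
`h_{r,t}` of the unified-(r,t) entropy is not subadditive: `h_{r,t}(σ) > 2·h_{r,t}(ρ)`. -/
theorem unified_rt_not_subadditive
    {d : ℕ} (r t : ℝ) (hr0 : 0 < r) (hr1 : r < 1) (ht0 : 0 < t) (ht1 : t ≤ 1)
    (ρ : Matrix (Fin d) (Fin d) ℂ) (hρ : ρ.PosSemidef) (htr : ρ.trace = 1)
    (hmixed : trRPow ρ 2 < 1) :
    trRPow ρ r ^ t + trRPow ρ r ^ t < 1 + trRPow (ρ ⊗ₖ ρ) r ^ t ∧
    (trRPow ρ r ^ t - 1) / ((1 - r) * t) + (trRPow ρ r ^ t - 1) / ((1 - r) * t)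
        < (trRPow (ρ ⊗ₖ ρ) r ^ t - 1) / ((1 - r) * t) := by
  have hx := one_lt_trRPow hρ htr hmixed hr1
  have hy : 1 < trRPow ρ r ^ t := Real.one_lt_rpow hx ht0
  have hmain : trRPow ρ r ^ t + trRPow ρ r ^ t < 1 + trRPow (ρ ⊗ₖ ρ) r ^ t := by
    rw [trRPow_kronecker hρ hρ, Real.mul_rpow (by linarith) (by linarith)]
    nlinarith [mul_pos (sub_pos.2 hy) (sub_pos.2 hy)]
  refine ⟨hmain, ?_⟩
  rw [← add_div]
  exact div_lt_div_of_pos_right (by linarith) (mul_pos (sub_pos.2 hr1) ht0)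
end

section
/- Let ψ be a tripartite pure state on ℂ^{d_A} ⊗ ℂ^{d_B} ⊗ ℂ^{d_C} with single-party reduced density matrices ρ_A, ρ_B, ρ_C, and let α > 0 be a real number. Then ⟨ψ| (ρ_A^α ⊗ ρ_B^α ⊗ ρ_C^α) |ψ⟩ ≤ ⟨ψ| (ρ_A^α ⊗ ρ_B^α ⊗ I_C) |ψ⟩, and equality holds if and only if ψ factorizes across the cut AB|C, i.e., there exist φ : Fin d_A × Fin d_B → ℂ and χ : Fin d_C → ℂ with ψ(a,b,c) = φ(a,b)·χ(c) for all a,b,c. -/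
open scoped Kronecker Matrix ComplexOrder

open Matrix in
/-- Acting with `U ⊗ W` on a bipartite vector multiplies its coefficient matrix by `U` on the left
and `Wᵀ` on the right. -/
theorem of_curry_kronecker_mulVec {m n : Type*} [Fintype m] [Fintype n]
    (U : Matrix m m ℂ) (W : Matrix n n ℂ) (ψ : m × n → ℂ) :
    (of fun i x => ((U ⊗ₖ W) *ᵥ ψ) (i, x)) = U * (of fun i x => ψ (i, x)) * Wᵀ := by
  ext i x
  simp only [of_apply, mulVec, dotProduct, kroneckerMap_apply, mul_apply, transpose_apply,
    Fintype.sum_prod_type, Finset.sum_mul]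
  rw [Finset.sum_comm]
  exact Finset.sum_congr rfl fun _ _ => Finset.sum_congr rfl fun _ _ => by ring

open Matrix in
/-- In an eigenbasis of the reduced matrix of a bipartite vector, the reduced matrix is the diagonal
matrix of its eigenvalues, whatever isometry is applied to the other factor. -/
theorem sum_kronecker_eigenvectorUnitary_mulVec {m n : Type*} [Fintype m] [DecidableEq m]
    [Fintype n] [DecidableEq n] (ψ : m × n → ℂ) (ρ : Matrix m m ℂ) (h : ρ.IsHermitian)
    (hρ : ∀ i i', ρ i i' = ∑ x, ψ (i, x) * star (ψ (i', x)))
    (W : Matrix n n ℂ) (hW : Wᴴ * W = 1) (i i' : m) :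
    ∑ x, (((h.eigenvectorUnitary : Matrix m m ℂ)ᴴ ⊗ₖ W) *ᵥ ψ) (i, x) *
      star ((((h.eigenvectorUnitary : Matrix m m ℂ)ᴴ ⊗ₖ W) *ᵥ ψ) (i', x)) =
      if i = i' then (h.eigenvalues i : ℂ) else 0 := by
  set U : Matrix m m ℂ := (h.eigenvectorUnitary : Matrix m m ℂ) with hU
  have hUU : Uᴴ * U = 1 := Unitary.coe_star_mul_self h.eigenvectorUnitary
  let Ψ : Matrix m n ℂ := of fun i x => ψ (i, x)
  let Φ : Matrix m n ℂ := of fun i x => ((Uᴴ ⊗ₖ W) *ᵥ ψ) (i, x)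
  have hΦ : Φ = Uᴴ * Ψ * Wᵀ := of_curry_kronecker_mulVec _ _ _
  have hΨ : Ψ * Ψᴴ = ρ := by
    ext i i'
    simp [Ψ, mul_apply, hρ]
  have hWt : Wᵀ * Wᵀᴴ = 1 := by
    rw [show Wᵀᴴ = Wᴴᵀ from rfl, ← transpose_mul, hW, transpose_one]
  have hspec : ρ = U * diagonal (fun i => (h.eigenvalues i : ℂ)) * Uᴴ := h.spectral_theorem
  have key : Φ * Φᴴ = diagonal (fun i => (h.eigenvalues i : ℂ)) := by
    calc Φ * Φᴴ = Uᴴ * Ψ * (Wᵀ * Wᵀᴴ) * Ψᴴ * U := by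
          rw [hΦ]; simp only [conjTranspose_mul, conjTranspose_conjTranspose, Matrix.mul_assoc]
      _ = Uᴴ * (Ψ * Ψᴴ) * U := by
          rw [hWt]; simp only [Matrix.mul_one, Matrix.mul_assoc]
      _ = (Uᴴ * U) * diagonal (fun i => (h.eigenvalues i : ℂ)) * (Uᴴ * U) := by
          rw [hΨ]
          conv_lhs => rw [hspec]
          simp only [Matrix.mul_assoc]
      _ = _ := by rw [hUU, Matrix.one_mul, Matrix.mul_one]
  have := congrFun (congrFun key i) i'
  rw [mul_apply, diagonal_apply] at this
  exact this

open Matrix in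
/-- The quadratic form of `V D Vᴴ` with `D` real diagonal. -/
theorem re_star_dotProduct_conj_diagonal_mulVec {n : Type*} [Fintype n] [DecidableEq n]
    (V : Matrix n n ℂ) (d : n → ℝ) (ψ : n → ℂ) :
    (star ψ ⬝ᵥ (V * diagonal (fun x => (d x : ℂ)) * Vᴴ) *ᵥ ψ).re =
      ∑ x, d x * ‖(Vᴴ *ᵥ ψ) x‖ ^ 2 := by
  have : star ψ ⬝ᵥ (V * diagonal (fun x => (d x : ℂ)) * Vᴴ) *ᵥ ψ =
      star (Vᴴ *ᵥ ψ) ⬝ᵥ (diagonal (fun x => (d x : ℂ)) *ᵥ (Vᴴ *ᵥ ψ)) := by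
    rw [star_mulVec, conjTranspose_conjTranspose, ← dotProduct_mulVec, mulVec_mulVec, mulVec_mulVec,
      Matrix.mul_assoc]
  rw [this, dotProduct, Complex.re_sum]
  refine Finset.sum_congr rfl fun x _ => ?_
  have hx : star ((Vᴴ *ᵥ ψ) x) * (Vᴴ *ᵥ ψ) x = ((‖(Vᴴ *ᵥ ψ) x‖ ^ 2 : ℝ) : ℂ) := by
    push_cast
    exact Complex.conj_mul' _
  rw [mulVec_diagonal, Pi.star_apply, mul_left_comm, hx, ← Complex.ofReal_mul, Complex.ofReal_re]

/-- Sums of a nonnegative `w` on a product of three sets, weighted by powers of `p`, `q`, `r`, where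
`p` and `q` dominate `w` and `r` takes values in `[0, 1]`: dropping the factor `r` does not decrease
the sum, and equality means that `r` takes the value `1` on the support of `w`. -/
theorem sum_marginal_rpow_le_and_eq_iff {I J K : Type*} [Fintype I] [Fintype J] [Fintype K]
    {α : ℝ} (hα : 0 < α) (w : I × J × K → ℝ) (hw : ∀ x, 0 ≤ w x)
    (p : I → ℝ) (q : J → ℝ) (r : K → ℝ)
    (hp : ∀ i j k, w (i, j, k) ≤ p i) (hq : ∀ i j k, w (i, j, k) ≤ q j)
    (hp0 : ∀ i, 0 ≤ p i) (hq0 : ∀ j, 0 ≤ q j) (hr0 : ∀ k, 0 ≤ r k) (hr1 : ∀ k, r k ≤ 1) :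
    ∑ x : I × J × K, p x.1 ^ α * (q x.2.1 ^ α * r x.2.2 ^ α) * w x ≤
        ∑ x : I × J × K, p x.1 ^ α * (q x.2.1 ^ α * 1) * w x ∧
      (∑ x : I × J × K, p x.1 ^ α * (q x.2.1 ^ α * r x.2.2 ^ α) * w x =
        ∑ x : I × J × K, p x.1 ^ α * (q x.2.1 ^ α * 1) * w x ↔
        ∀ i j k, w (i, j, k) ≠ 0 → r k = 1) := by
  have hle : ∀ x ∈ (Finset.univ : Finset (I × J × K)),
      p x.1 ^ α * (q x.2.1 ^ α * r x.2.2 ^ α) * w x ≤ p x.1 ^ α * (q x.2.1 ^ α * 1) * w x := by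
    intro x _
    have h1 := Real.rpow_nonneg (hp0 x.1) α
    have h2 := Real.rpow_nonneg (hq0 x.2.1) α
    have h3 := Real.rpow_le_one (hr0 x.2.2) (hr1 x.2.2) hα.le
    have h4 := hw x
    gcongr
  refine ⟨Finset.sum_le_sum hle, ?_⟩
  rw [Finset.sum_eq_sum_iff_of_le hle]
  constructor
  · intro h i j k hne
    have hpos : 0 < w (i, j, k) := lt_of_le_of_ne (hw _) hne.symm
    have h1 := Real.rpow_pos_of_pos (hpos.trans_le (hp i j k)) α
    have h2 := Real.rpow_pos_of_pos (hpos.trans_le (hq i j k)) α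
    have h3 := mul_left_cancel₀ h2.ne'
      (mul_left_cancel₀ h1.ne' (mul_right_cancel₀ hne (h (i, j, k) (Finset.mem_univ _))))
    exact (Real.rpow_left_inj (hr0 k) zero_le_one hα.ne').1 (by simpa using h3)
  · rintro h ⟨i, j, k⟩ -
    by_cases hne : w (i, j, k) = 0
    · simp [hne]
    · simp [h i j k hne]

/-- For a tripartite pure state `ψ` with single-party reduced states
`ρ_A`, `ρ_B`, `ρ_C` and real `α > 0`:
`⟨ψ| ρ_A^α ⊗ ρ_B^α ⊗ ρ_C^α |ψ⟩ ≤ ⟨ψ| ρ_A^α ⊗ ρ_B^α ⊗ I_C |ψ⟩`, with equality iff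
`ψ` factorizes across the cut `AB|C`. -/
theorem inner_matRPow_le_inner_one
    {dA dB dC : ℕ} (α : ℝ) (hα : 0 < α)
    (ψ : Fin dA × Fin dB × Fin dC → ℂ) (hψ : ∑ x, ‖ψ x‖ ^ 2 = 1) :
    let ρA : Matrix (Fin dA) (Fin dA) ℂ :=
      Matrix.of fun a a' => ∑ b, ∑ c, ψ (a, b, c) * (starRingEnd ℂ) (ψ (a', b, c))
    let ρB : Matrix (Fin dB) (Fin dB) ℂ :=
      Matrix.of fun b b' => ∑ a, ∑ c, ψ (a, b, c) * (starRingEnd ℂ) (ψ (a, b', c))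
    let ρC : Matrix (Fin dC) (Fin dC) ℂ :=
      Matrix.of fun c c' => ∑ a, ∑ b, ψ (a, b, c) * (starRingEnd ℂ) (ψ (a, b, c'))
    (star ψ ⬝ᵥ (matRPow ρA α ⊗ₖ (matRPow ρB α ⊗ₖ matRPow ρC α)).mulVec ψ).re
        ≤ (star ψ ⬝ᵥ (matRPow ρA α ⊗ₖ (matRPow ρB α ⊗ₖ (1 : Matrix (Fin dC) (Fin dC) ℂ))).mulVec ψ).re ∧
      ((star ψ ⬝ᵥ (matRPow ρA α ⊗ₖ (matRPow ρB α ⊗ₖ matRPow ρC α)).mulVec ψ).re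
          = (star ψ ⬝ᵥ (matRPow ρA α ⊗ₖ (matRPow ρB α ⊗ₖ (1 : Matrix (Fin dC) (Fin dC) ℂ))).mulVec ψ).re ↔
        ∃ (φ : Fin dA × Fin dB → ℂ) (χ : Fin dC → ℂ),
          ∀ a b c, ψ (a, b, c) = φ (a, b) * χ c) := by
  intro ρA ρB ρC
  have hA : ρA.IsHermitian := by
    ext a a'
    simp [ρA, Matrix.conjTranspose_apply, mul_comm]
  have hB : ρB.IsHermitian := by
    ext a a'
    simp [ρB, Matrix.conjTranspose_apply, mul_comm]
  have hC : ρC.IsHermitian := by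
    ext a a'
    simp [ρC, Matrix.conjTranspose_apply, mul_comm]
  set U : Matrix (Fin dA) (Fin dA) ℂ := ↑hA.eigenvectorUnitary with hU
  set V : Matrix (Fin dB) (Fin dB) ℂ := ↑hB.eigenvectorUnitary with hV
  set W : Matrix (Fin dC) (Fin dC) ℂ := ↑hC.eigenvectorUnitary with hW
  have hUU : U * Uᴴ = 1 := Unitary.coe_mul_star_self hA.eigenvectorUnitary
  have hVV : V * Vᴴ = 1 := Unitary.coe_mul_star_self hB.eigenvectorUnitary
  have hWW : W * Wᴴ = 1 := Unitary.coe_mul_star_self hC.eigenvectorUnitary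
  set T := U ⊗ₖ (V ⊗ₖ W) with hT
  have hTT : T * Tᴴ = 1 := by
    simp [hT, Matrix.conjTranspose_kronecker, ← Matrix.mul_kronecker_mul, hUU, hVV, hWW]
  set φ := Tᴴ.mulVec ψ with hφ
  have hTφ : T.mulVec φ = ψ := by rw [hφ, Matrix.mulVec_mulVec, hTT, Matrix.one_mulVec]
  have hφ_apply : ∀ i j k, φ (i, j, k) =
      ∑ a, ∑ b, ∑ c, star (U a i) * (star (V b j) * star (W c k)) * ψ (a, b, c) := by
    intro i j k
    simp [hφ, hT, Matrix.mulVec, dotProduct, Fintype.sum_prod_type]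
  have margA : ∀ i i', ∑ j, ∑ k, φ (i, j, k) * star (φ (i', j, k)) =
      if i = i' then (hA.eigenvalues i : ℂ) else 0 := by
    intro i i'
    rw [← sum_kronecker_eigenvectorUnitary_mulVec ψ ρA hA
      (fun i i' => by simp [ρA, Fintype.sum_prod_type]) (Vᴴ ⊗ₖ Wᴴ)
      (by simp [Matrix.conjTranspose_kronecker, ← Matrix.mul_kronecker_mul, hVV, hWW]) i i',
      Fintype.sum_prod_type]
    simp only [hφ, hT, Matrix.conjTranspose_kronecker, ← hU]
  have margB : ∀ j j', ∑ i, ∑ k, φ (i, j, k) * star (φ (i, j', k)) =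
      if j = j' then (hB.eigenvalues j : ℂ) else 0 := by
    intro j j'
    let ψ' : Fin dB × Fin dA × Fin dC → ℂ := fun x => ψ (x.2.1, x.1, x.2.2)
    have hφ' : ∀ i j k, (Vᴴ ⊗ₖ (Uᴴ ⊗ₖ Wᴴ)).mulVec ψ' (j, i, k) = φ (i, j, k) := by
      intro i j k
      rw [hφ_apply, Finset.sum_comm]
      simp only [Matrix.mulVec, dotProduct, Fintype.sum_prod_type, Matrix.kroneckerMap_apply,
        Matrix.conjTranspose_apply, ψ']
      exact Finset.sum_congr rfl fun _ _ => Finset.sum_congr rfl fun _ _ =>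
        Finset.sum_congr rfl fun _ _ => by ring
    rw [← sum_kronecker_eigenvectorUnitary_mulVec ψ' ρB hB
      (fun i i' => by simp [ρB, ψ', Fintype.sum_prod_type]) (Uᴴ ⊗ₖ Wᴴ)
      (by simp [Matrix.conjTranspose_kronecker, ← Matrix.mul_kronecker_mul, hUU, hWW]) j j',
      Fintype.sum_prod_type]
    simp only [← hV, hφ']
  have margC : ∀ k k', ∑ i, ∑ j, φ (i, j, k) * star (φ (i, j, k')) =
      if k = k' then (hC.eigenvalues k : ℂ) else 0 := by
    intro k k'
    let ψ' : Fin dC × Fin dA × Fin dB → ℂ := fun x => ψ (x.2.1, x.2.2, x.1)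
    have hφ' : ∀ i j k, (Wᴴ ⊗ₖ (Uᴴ ⊗ₖ Vᴴ)).mulVec ψ' (k, i, j) = φ (i, j, k) := by
      intro i j k
      rw [hφ_apply]
      simp only [Matrix.mulVec, dotProduct, Fintype.sum_prod_type, Matrix.kroneckerMap_apply,
        Matrix.conjTranspose_apply, ψ']
      rw [Finset.sum_comm]
      refine Finset.sum_congr rfl fun _ _ => ?_
      rw [Finset.sum_comm]
      exact Finset.sum_congr rfl fun _ _ => Finset.sum_congr rfl fun _ _ => by ring
    rw [← sum_kronecker_eigenvectorUnitary_mulVec ψ' ρC hC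
      (fun i i' => by simp [ρC, ψ', Fintype.sum_prod_type]) (Uᴴ ⊗ₖ Vᴴ)
      (by simp [Matrix.conjTranspose_kronecker, ← Matrix.mul_kronecker_mul, hUU, hVV]) k k',
      Fintype.sum_prod_type]
    simp only [← hW, hφ']
  have hsq : ∀ z : ℂ, z * star z = ((‖z‖ ^ 2 : ℝ) : ℂ) := fun z => by
    push_cast
    exact Complex.mul_conj' z
  have eigA : ∀ i, ∑ j, ∑ k, ‖φ (i, j, k)‖ ^ 2 = hA.eigenvalues i := by
    intro i
    have := margA i i
    simp only [hsq, if_true] at this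
    exact_mod_cast this
  have eigB : ∀ j, ∑ i, ∑ k, ‖φ (i, j, k)‖ ^ 2 = hB.eigenvalues j := by
    intro j
    have := margB j j
    simp only [hsq, if_true] at this
    exact_mod_cast this
  have eigC : ∀ k, ∑ i, ∑ j, ‖φ (i, j, k)‖ ^ 2 = hC.eigenvalues k := by
    intro k
    have := margC k k
    simp only [hsq, if_true] at this
    exact_mod_cast this
  have le_sum_sum : ∀ {m n : ℕ} (f : Fin m → Fin n → ℝ) (_ : ∀ i j, 0 ≤ f i j) (i j),
      f i j ≤ ∑ i, ∑ j, f i j := fun f hf i j =>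
    (Finset.single_le_sum (fun j _ => hf i j) (Finset.mem_univ j)).trans
      (Finset.single_le_sum (f := fun i => ∑ j, f i j)
        (fun i _ => Finset.sum_nonneg fun j _ => hf i j) (Finset.mem_univ i))
  have hp0 : ∀ i, 0 ≤ hA.eigenvalues i := fun i => by rw [← eigA]; positivity
  have hq0 : ∀ i, 0 ≤ hB.eigenvalues i := fun i => by rw [← eigB]; positivity
  have hr0 : ∀ i, 0 ≤ hC.eigenvalues i := fun i => by rw [← eigC]; positivity
  have hsum : ∑ k, hC.eigenvalues k = 1 := by
    have htr : ρC.trace = 1 := by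
      have h1 : ((∑ x, ‖ψ x‖ ^ 2 : ℝ) : ℂ) = 1 := by rw [hψ, Complex.ofReal_one]
      rw [← h1, Complex.ofReal_sum]
      simp only [← hsq, Fintype.sum_prod_type, Matrix.trace, Matrix.diag_apply, ρC, Matrix.of_apply]
      rw [Finset.sum_comm]
      refine Finset.sum_congr rfl fun _ _ => ?_
      rw [Finset.sum_comm]
      rfl
    rw [hC.trace_eq_sum_eigenvalues] at htr
    exact Complex.ofReal_injective (by push_cast; exact htr)
  have hr1 : ∀ k, hC.eigenvalues k ≤ 1 := fun k => by
    rw [← hsum]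
    exact Finset.single_le_sum (fun k _ => hr0 k) (Finset.mem_univ k)
  have expect_rpow : (star ψ ⬝ᵥ
      (matRPow ρA α ⊗ₖ (matRPow ρB α ⊗ₖ matRPow ρC α)).mulVec ψ).re =
      ∑ x : Fin dA × Fin dB × Fin dC, hA.eigenvalues x.1 ^ α *
        (hB.eigenvalues x.2.1 ^ α * hC.eigenvalues x.2.2 ^ α) * ‖φ x‖ ^ 2 := by
    rw [hφ, ← re_star_dotProduct_conj_diagonal_mulVec]
    congr 4
    simp only [matRPow, dif_pos hA, dif_pos hB, dif_pos hC, Matrix.mul_kronecker_mul,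
      Matrix.diagonal_kronecker_diagonal, hT, Matrix.conjTranspose_kronecker,
      Matrix.star_eq_conjTranspose, Complex.ofReal_mul, ← hU, ← hV, ← hW]
  have expect_one : (star ψ ⬝ᵥ (matRPow ρA α ⊗ₖ
      (matRPow ρB α ⊗ₖ (1 : Matrix (Fin dC) (Fin dC) ℂ))).mulVec ψ).re =
      ∑ x : Fin dA × Fin dB × Fin dC, hA.eigenvalues x.1 ^ α *
        (hB.eigenvalues x.2.1 ^ α * 1) * ‖φ x‖ ^ 2 := by
    rw [hφ, ← re_star_dotProduct_conj_diagonal_mulVec]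
    congr 4
    have h1 : (1 : Matrix (Fin dC) (Fin dC) ℂ) =
        W * Matrix.diagonal (fun _ => ((1 : ℝ) : ℂ)) * Wᴴ := by
      simp [hWW]
    rw [h1]
    simp only [matRPow, dif_pos hA, dif_pos hB, Matrix.mul_kronecker_mul,
      Matrix.diagonal_kronecker_diagonal, hT, Matrix.conjTranspose_kronecker,
      Matrix.star_eq_conjTranspose, Complex.ofReal_mul, ← hU, ← hV]
  rw [expect_rpow, expect_one]
  obtain ⟨hle, heq⟩ := sum_marginal_rpow_le_and_eq_iff hα (fun x => ‖φ x‖ ^ 2)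
    (fun x => by positivity) hA.eigenvalues hB.eigenvalues hC.eigenvalues
    (fun i j k => by
      rw [← eigA]; exact le_sum_sum (fun j k => ‖φ (i, j, k)‖ ^ 2) (fun _ _ => by positivity) j k)
    (fun i j k => by
      rw [← eigB]; exact le_sum_sum (fun i k => ‖φ (i, j, k)‖ ^ 2) (fun _ _ => by positivity) i k)
    hp0 hq0 hr0 hr1
  refine ⟨hle, heq.trans ⟨fun h => ?_, ?_⟩⟩
  · obtain ⟨k₀, hk₀⟩ : ∃ k₀, ∀ i j k, k ≠ k₀ → φ (i, j, k) = 0 := by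
      by_cases hex : ∃ i j k, φ (i, j, k) ≠ 0
      · obtain ⟨i₀, j₀, k₀, h₀⟩ := hex
        have hone : hC.eigenvalues k₀ = 1 := h i₀ j₀ k₀ (by simpa using h₀)
        refine ⟨k₀, fun i j k hk => ?_⟩
        by_contra hne
        have hone' : hC.eigenvalues k = 1 := h i j k (by simpa using hne)
        have := Finset.add_le_sum (fun k _ => hr0 k) (Finset.mem_univ k) (Finset.mem_univ k₀) hk
        linarith
      · push Not at hex
        have : Nonempty (Fin dC) := by
          by_contra hemp
          rw [not_nonempty_iff] at hemp
          simp at hsum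
        exact ⟨this.some, fun i j k _ => hex i j k⟩
    refine ⟨fun x => ∑ i, ∑ j, U x.1 i * V x.2 j * φ (i, j, k₀), fun c => W c k₀, fun a b c => ?_⟩
    rw [← hTφ]
    simp only [Matrix.mulVec, dotProduct, Fintype.sum_prod_type, hT, Matrix.kroneckerMap_apply,
      Finset.sum_mul]
    refine Finset.sum_congr rfl fun i _ => Finset.sum_congr rfl fun j _ => ?_
    rw [Finset.sum_eq_single k₀ (fun k _ hk => by rw [hk₀ i j k hk, mul_zero]) (by simp)]
    ring
  · rintro ⟨f, g, hfg⟩ i j k hne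
    let F : Fin dA → Fin dB → ℂ := fun i j => ∑ a, ∑ b, star (U a i) * star (V b j) * f (a, b)
    let G : Fin dC → ℂ := fun k => ∑ c, star (W c k) * g c
    have hFG : ∀ i j k, φ (i, j, k) = F i j * G k := by
      intro i j k
      rw [hφ_apply]
      simp only [F, hfg, Finset.sum_mul]
      simp only [G, Finset.mul_sum]
      exact Finset.sum_congr rfl fun _ _ => Finset.sum_congr rfl fun _ _ =>
        Finset.sum_congr rfl fun _ _ => by ring
    have hφne : F i j * G k ≠ 0 := by
      rw [← hFG]
      simpa using hne
    obtain ⟨hF, hG⟩ := mul_ne_zero_iff.1 hφne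
    have hother : ∀ k', k' ≠ k → hC.eigenvalues k' = 0 := by
      intro k' hk'
      have hN : ∑ i, ∑ j, ‖F i j‖ ^ 2 ≠ 0 := by
        have := le_sum_sum (fun i j => ‖F i j‖ ^ 2) (fun _ _ => by positivity) i j
        have : 0 < ‖F i j‖ ^ 2 := by positivity
        linarith
      have h0 := margC k' k
      have hfac : ∑ i, ∑ j, φ (i, j, k') * star (φ (i, j, k)) =
          ((∑ i, ∑ j, ‖F i j‖ ^ 2 : ℝ) : ℂ) * (G k' * star (G k)) := by
        simp only [Complex.ofReal_sum, ← hsq, Finset.sum_mul, hFG, star_mul']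
        exact Finset.sum_congr rfl fun _ _ => Finset.sum_congr rfl fun _ _ => by ring
      rw [if_neg hk', hfac] at h0
      have hGk' : G k' = 0 := by
        simpa [hN, hG] using (mul_eq_zero.1 h0).resolve_left (by exact_mod_cast hN)
      rw [← eigC]
      simp [hFG, hGk']
    rw [← hsum]
    exact (Finset.sum_eq_single k (fun k' _ hk' => hother k' hk') (by simp)).symm
end

section
/- Let p > 0 be a real number. There exists x₀ with 0 < x₀ < 1/2 such that for all real x with 0 < x < x₀, one has (1−2x)^{p+1}·(1−x)^{2p} + 2·x^{2p+1}·(1−x)^p > (1−2x)^{2p+1} + 2·x^{2p+1}. (This is the inequality showing that the fidelity-type global measure built from the unified-(q,s) entropy with p = (q−1)/2 violates the hierarchy condition on the two-qubit diagonal state diag(1−2x, x, x, 0).) -/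
open scoped Kronecker Matrix ComplexOrder

/-- First-order lower bound for the increment of a real power. -/
theorem rpow_mul_le_rpow_sub_rpow {a b p : ℝ} (ha : 0 < a) (hb : 0 < b) (hp : 0 ≤ p) :
    a ^ p * (p * (1 - a / b)) ≤ b ^ p - a ^ p := by
  have hlog : 1 - a / b ≤ Real.log (b / a) := by
    simpa using Real.one_sub_inv_le_log_of_pos (div_pos hb ha)
  have hexp : 1 + p * (1 - a / b) ≤ (b / a) ^ p := by
    rw [Real.rpow_def_of_pos (div_pos hb ha)]
    have h₁ := Real.add_one_le_exp (Real.log (b / a) * p)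
    have h₂ := mul_le_mul_of_nonneg_left hlog hp
    linarith
  have hmul := mul_le_mul_of_nonneg_left hexp (Real.rpow_nonneg ha.le p)
  rw [← Real.mul_rpow ha.le (div_pos hb ha).le, mul_div_cancel₀ _ ha.ne'] at hmul
  linarith

theorem one_sub_rpow_le {c p : ℝ} (hc : 0 < c) : 1 - c ^ p ≤ p * -Real.log c := by
  rw [Real.rpow_def_of_pos hc]
  linarith [Real.add_one_le_exp (Real.log c * p)]

theorem eventually_two_mul_rpow_lt {p : ℝ} (hp : 0 < p) :
    ∀ᶠ x : ℝ in nhds 0, 2 * x ^ (2 * p) < (1 - 2 * x) ^ (2 * p + 1) * (1 - x) := by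
  have hl : ContinuousAt (fun x : ℝ => 2 * x ^ (2 * p)) 0 :=
    continuousAt_const.mul (continuousAt_id.rpow_const (Or.inr (by positivity)))
  have hr : ContinuousAt (fun x : ℝ => (1 - 2 * x) ^ (2 * p + 1) * (1 - x)) 0 := by
    refine ContinuousAt.mul (ContinuousAt.rpow_const ?_ (Or.inr (by positivity))) ?_ <;> fun_prop
  refine hl.eventually_lt hr ?_
  simp [Real.zero_rpow (show 2 * p ≠ 0 by positivity)]

/-- For real `p > 0` there is `0 < x₀ < 1/2` such that for all
`0 < x < x₀`:
`(1-2x)^{p+1}·(1-x)^{2p} + 2x^{2p+1}·(1-x)^p > (1-2x)^{2p+1} + 2x^{2p+1}`. -/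
theorem hierarchy_violation_inequality
    (p : ℝ) (hp : 0 < p) :
    ∃ x₀ : ℝ, 0 < x₀ ∧ x₀ < 1/2 ∧ ∀ x : ℝ, 0 < x → x < x₀ →
      (1 - 2*x) ^ (2*p + 1) + 2 * x ^ (2*p + 1)
        < (1 - 2*x) ^ (p + 1) * (1 - x) ^ (2*p) + 2 * x ^ (2*p + 1) * (1 - x) ^ p := by
  obtain ⟨ε, hε, hball⟩ := Metric.eventually_nhds_iff.mp (eventually_two_mul_rpow_lt hp)
  refine ⟨min ε (1 / 4), by positivity, (min_le_right _ _).trans_lt (by norm_num),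
    fun x hx hxlt => ?_⟩
  have hxε : x < ε := hxlt.trans_le (min_le_left _ _)
  have hx4 : x < 1 / 4 := hxlt.trans_le (min_le_right _ _)
  have hkey := hball (y := x) (by simpa [abs_of_pos hx] using hxε)
  have ha : 0 < 1 - 2 * x := by linarith
  have hc : 0 < 1 - x := by linarith
  have hsq : (1 - x) ^ (2 * p) = ((1 - x) ^ 2) ^ p := by
    rw [Real.rpow_mul hc.le, Real.rpow_two]
  have hgap : x ^ 2 ≤ 1 - (1 - 2 * x) / (1 - x) ^ 2 := by
    rw [one_sub_div (by positivity), le_div_iff₀ (by positivity)]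
    have h₁ : (1 - x) ^ 2 ≤ 1 := by nlinarith
    nlinarith [mul_le_mul_of_nonneg_left h₁ (sq_nonneg x)]
  have hmain : (1 - 2 * x) ^ p * (p * x ^ 2) ≤ (1 - x) ^ (2 * p) - (1 - 2 * x) ^ p := by
    rw [hsq]
    refine le_trans ?_ (rpow_mul_le_rpow_sub_rpow ha (by positivity) hp.le)
    gcongr
  have hlog : -Real.log (1 - x) ≤ x / (1 - x) := by
    have h₁ := Real.one_sub_inv_le_log_of_pos hc
    have h₂ : x / (1 - x) = (1 - x)⁻¹ - 1 := by field_simp; ring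
    linarith
  have hloss : 1 - (1 - x) ^ p ≤ p * (x / (1 - x)) :=
    (one_sub_rpow_le hc).trans (mul_le_mul_of_nonneg_left hlog hp.le)
  have hfac : (1 - 2 * x) ^ (2 * p + 1) = (1 - 2 * x) ^ (p + 1) * (1 - 2 * x) ^ p := by
    rw [← Real.rpow_add ha]; ring_nf
  have hxfac : x ^ (2 * p + 1) = x ^ (2 * p) * x := by
    rw [Real.rpow_add hx, Real.rpow_one]
  have hgain : (1 - 2 * x) ^ (2 * p + 1) * (p * x ^ 2)
      ≤ (1 - 2 * x) ^ (p + 1) * ((1 - x) ^ (2 * p) - (1 - 2 * x) ^ p) := by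
    rw [hfac, mul_assoc]
    exact mul_le_mul_of_nonneg_left hmain (by positivity)
  have hcost : 2 * x ^ (2 * p + 1) * (1 - (1 - x) ^ p)
      ≤ 2 * x ^ (2 * p + 1) * (p * (x / (1 - x))) :=
    mul_le_mul_of_nonneg_left hloss (by positivity)
  have hcmp : 2 * x ^ (2 * p + 1) * (p * (x / (1 - x)))
      < (1 - 2 * x) ^ (2 * p + 1) * (p * x ^ 2) := by
    have h₁ : 2 * x ^ (2 * p + 1) * (p * (x / (1 - x)))
        = 2 * x ^ (2 * p) / (1 - x) * (p * x ^ 2) := by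
      rw [hxfac]; ring
    rw [h₁]
    exact mul_lt_mul_of_pos_right ((div_lt_iff₀ hc).mpr hkey) (by positivity)
  have htotal := hcost.trans_lt (hcmp.trans_le hgain)
  rw [mul_sub, mul_sub, ← hfac] at htotal
  linarith
end

section
/- Let q > 1 and s > 0 be real numbers, let d ≥ 1, and let ψ be a tripartite pure state on ℂ^d ⊗ ℂ^d ⊗ ℂ^d with single-party reduced density matrices ρ_A, ρ_B, ρ_C. Define h(ρ) = (1 − (tr ρ^q)^s)/((q−1)·s) and c_d = d^{−(q−1)s}. Then min{h(ρ_A), h(ρ_B), h(ρ_C)} ≥ h(ρ_A) + h(ρ_B) + h(ρ_C) + 2·(c_d − 1)/((q−1)·s). (This is the tripartite pure-state case of the lower bounds relating the genuine entanglement measure E_{g(q,s)}, the bipartite cut entanglements, and the global measure E^{(3)}_{q,s} = (1/2)(h(ρ_A)+h(ρ_B)+h(ρ_C)), since for a tripartite pure state every bipartition has a single-party side.) -/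
open scoped Kronecker Matrix ComplexOrder

/-- The power-mean lower bound `d^{-(q-1)s} ≤ (tr ρ^q)^s` for a Gram matrix `ρ = M Mᴴ` of
trace one. -/
theorem rpow_le_trRPow_mul_conjTranspose_rpow {n m : Type*} [Fintype n] [DecidableEq n] [Fintype m]
    {q s : ℝ} (hq : 1 < q) (hs : 0 < s) (M : Matrix n m ℂ)
    (hM : ∑ i, ∑ j, ‖M i j‖ ^ 2 = 1) :
    (Fintype.card n : ℝ) ^ (-(q - 1) * s) ≤ trRPow (M * Mᴴ) q ^ s := by
  have hpsd := Matrix.posSemidef_self_mul_conjTranspose M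
  have htr : (M * Mᴴ).trace = 1 := by
    simp only [Matrix.trace, Matrix.diag_apply, Matrix.mul_apply, Matrix.conjTranspose_apply,
      Complex.star_def, Complex.mul_conj, Complex.normSq_eq_norm_sq]
    exact_mod_cast hM
  have hsum : ∑ i, hpsd.isHermitian.eigenvalues i = 1 := by
    have := hpsd.isHermitian.trace_eq_sum_eigenvalues
    rw [htr] at this
    simpa using congrArg Complex.re this.symm
  have hcard : (0 : ℝ) < Fintype.card n := by
    rcases isEmpty_or_nonempty n with hn | hn
    · simp at hsum
    · exact_mod_cast Fintype.card_pos
  have hmean := Real.rpow_sum_le_const_mul_sum_rpow_of_nonneg Finset.univ hq.le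
    (fun i _ => hpsd.eigenvalues_nonneg i)
  rw [hsum, Real.one_rpow, Finset.card_univ] at hmean
  rw [trRPow, dif_pos hpsd.isHermitian, Real.rpow_mul hcard.le]
  refine Real.rpow_le_rpow (by positivity) ?_ hs.le
  rw [Real.rpow_neg hcard.le]
  exact (inv_le_iff_one_le_mul₀' (Real.rpow_pos_of_pos hcard _)).mpr hmean

/-- **Propositions 3 & 4, tripartite pure-state case.** For `q > 1`,
`s > 0`, `d ≥ 1` and a tripartite pure state `ψ` with single-party reduced states
`ρ_A, ρ_B, ρ_C`, with `h(ρ) = (1 - (tr ρ^q)^s)/((q-1)s)` and `c_d = d^{-(q-1)s}`: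
`min{h(ρ_A), h(ρ_B), h(ρ_C)} ≥ h(ρ_A) + h(ρ_B) + h(ρ_C) + 2(c_d - 1)/((q-1)s)`. -/
theorem genuine_lower_bound_qs
    {d : ℕ} (hd : 1 ≤ d) (q s : ℝ) (hq : 1 < q) (hs : 0 < s)
    (ψ : Fin d × Fin d × Fin d → ℂ) (hψ : ∑ x, ‖ψ x‖ ^ 2 = 1) :
    let ρA : Matrix (Fin d) (Fin d) ℂ :=
      Matrix.of fun a a' => ∑ b, ∑ c, ψ (a, b, c) * (starRingEnd ℂ) (ψ (a', b, c))
    let ρB : Matrix (Fin d) (Fin d) ℂ :=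
      Matrix.of fun b b' => ∑ a, ∑ c, ψ (a, b, c) * (starRingEnd ℂ) (ψ (a, b', c))
    let ρC : Matrix (Fin d) (Fin d) ℂ :=
      Matrix.of fun c c' => ∑ a, ∑ b, ψ (a, b, c) * (starRingEnd ℂ) (ψ (a, b, c'))
    let h : Matrix (Fin d) (Fin d) ℂ → ℝ := fun ρ => (1 - trRPow ρ q ^ s) / ((q - 1) * s)
    let cd : ℝ := (d : ℝ) ^ (-(q - 1) * s)
    h ρA + h ρB + h ρC + 2 * (cd - 1) / ((q - 1) * s)
      ≤ min (h ρA) (min (h ρB) (h ρC)) := by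
  intro ρA ρB ρC h cd
  have hbound : ∀ M : Matrix (Fin d) (Fin d × Fin d) ℂ, ∑ i, ∑ j, ‖M i j‖ ^ 2 = 1 →
      h (M * Mᴴ) ≤ (1 - cd) / ((q - 1) * s) := by
    intro M hM
    have hle := rpow_le_trRPow_mul_conjTranspose_rpow hq hs M hM
    rw [Fintype.card_fin] at hle
    have : 0 < (q - 1) * s := mul_pos (sub_pos.mpr hq) hs
    dsimp only [h, cd]
    gcongr
  simp only [Fintype.sum_prod_type] at hψ
  have hA : h ρA ≤ (1 - cd) / ((q - 1) * s) := by
    convert hbound (Matrix.of fun a x => ψ (a, x.1, x.2))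
      (by simpa only [Fintype.sum_prod_type, Matrix.of_apply] using hψ) using 2
    ext a a'
    simp [ρA, Matrix.mul_apply, Fintype.sum_prod_type]
  have hB : h ρB ≤ (1 - cd) / ((q - 1) * s) := by
    convert hbound (Matrix.of fun b x => ψ (x.1, b, x.2))
      (by
        rw [Finset.sum_comm] at hψ
        simpa only [Fintype.sum_prod_type, Matrix.of_apply] using hψ) using 2
    ext b b'
    simp [ρB, Matrix.mul_apply, Fintype.sum_prod_type]
  have hC : h ρC ≤ (1 - cd) / ((q - 1) * s) := by
    convert hbound (Matrix.of fun c x => ψ (x.1, x.2, c))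
      (by
        rw [Finset.sum_comm]
        simp only [Fintype.sum_prod_type, Matrix.of_apply]
        exact hψ) using 2
    ext c c'
    simp [ρC, Matrix.mul_apply, Fintype.sum_prod_type]
  have hsplit : 2 * (cd - 1) / ((q - 1) * s) = -(2 * ((1 - cd) / ((q - 1) * s))) := by ring
  rw [hsplit]
  refine le_min ?_ (le_min ?_ ?_) <;> linarith
end
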